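/- arXiv:1503.08329 — 5 statements merged into one kernel-verified Lean document; each statement's English description precedes it below -/
import Mathlib

section
/- For any distribution D on X × {-1,1}, any set H of voters f : X → [-1,1], any prior distribution P on H, any δ ∈ (0,1], and any two distinct choices α, β among the expected disagreement d, the expected joint error e, and the expected joint success s: with probability at least 1 − δ over the draw of S ∼ D^m, simultaneously for all posterior distributions Q on H, kl(α_Q^S, β_Q^S ‖ α_Q^D, β_Q^D) ≤ (1/m)·[2·KL(Q‖P) + ln((ξ(m)+m)/δ)]. -/
open MeasureTheory

open Classical in
/-- Kullback–Leibler divergence `KL(Q‖P) = E_{f∼Q} ln (dQ/dP)(f)`, with value `⊤`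
when `Q` is not absolutely continuous w.r.t. `P` or the divergence is not finite. -/
noncomputable def klDivE {ι : Type*} [MeasurableSpace ι] (Q P : Measure ι) : EReal :=
  if Q ≪ P ∧ Integrable (fun i => Real.log ((Q.rnDeriv P) i).toReal) Q
  then ((∫ i, Real.log ((Q.rnDeriv P) i).toReal ∂Q : ℝ) : EReal)
  else ⊤

/-- `kl(q₁,q₂ ‖ p₁,p₂)`: the KL divergence between two trivalent distributions. -/
noncomputable def klTri (q1 q2 p1 p2 : ℝ) : ℝ :=
  q1 * Real.log (q1 / p1) + q2 * Real.log (q2 / p2) +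
    (1 - q1 - q2) * Real.log ((1 - q1 - q2) / (1 - p1 - p2))

/-- `ξ(m) = Σ_{k=0}^m C(m,k)·(k/m)^k·(1 - k/m)^{m-k}` (with `0⁰ = 1`). -/
noncomputable def xi (m : ℕ) : ℝ :=
  ∑ k ∈ Finset.range (m + 1),
    (m.choose k : ℝ) * ((k : ℝ) / (m : ℝ)) ^ k * (1 - (k : ℝ) / (m : ℝ)) ^ (m - k)

/-- Paired loss giving the expected disagreement `d`. -/
noncomputable def pairedLossD : ℝ → ℝ → ℝ → ℝ := fun a b _ => (1 - a * b) / 2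

/-- Paired loss giving the expected joint error `e`. -/
noncomputable def pairedLossE : ℝ → ℝ → ℝ → ℝ :=
  fun a b y => ((1 - y * a) / 2) * ((1 - y * b) / 2)

/-- Paired loss giving the expected joint success `s`. -/
noncomputable def pairedLossS : ℝ → ℝ → ℝ → ℝ :=
  fun a b y => ((1 + y * a) / 2) * ((1 + y * b) / 2)

open Polynomial in
theorem sum_choose_mul_pow_mul_X_sub_pow (n : ℕ) :
    ∑ k ∈ Finset.range (n + 1), C (((n + 1).choose (k + 1) : ℝ) * ((k : ℝ) + 1) ^ k) *
      (X - C ((k : ℝ) + 1)) ^ (n - k) = C ((n : ℝ) + 1) * X ^ n := by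
  induction n with
  | zero => simp
  | succ n ih =>
    have hderiv : ∀ p q : ℝ[X], derivative p = derivative q → p.eval 0 = q.eval 0 → p = q := by
      intro p q h h0
      have h1 : derivative (p - q) = 0 := by simp [h]
      have h2 := Polynomial.eq_C_of_derivative_eq_zero h1
      have h3 : (p - q).eval 0 = 0 := by simp [h0]
      rw [h2] at h3
      simp only [eval_C] at h3
      rw [h3, C_0] at h2
      exact sub_eq_zero.mp h2
    apply hderiv
    · have h1 : derivative (C (((n + 1 : ℕ) : ℝ) + 1) * X ^ (n + 1) : ℝ[X]) =
          C ((n : ℝ) + 2) * (C ((n : ℝ) + 1) * X ^ n) := by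
        simp only [derivative_C_mul, derivative_X_pow]
        push_cast
        simp only [map_add, map_one, map_natCast, C_ofNat]
        ring
      rw [h1, ← ih, derivative_sum, Finset.sum_range_succ, Finset.mul_sum]
      simp only [derivative_C_mul, Nat.sub_self, pow_zero, derivative_one, mul_zero, add_zero]
      refine Finset.sum_congr rfl fun k hk => ?_
      have hk' : k ≤ n := by simpa [Nat.lt_succ_iff] using hk
      have h2 : n + 1 - k = n - k + 1 := by omega
      have h3 : ((n + 2).choose (k + 1) : ℝ) * ((n - k : ℕ) + 1 : ℝ)
          = (n + 2) * ((n + 1).choose (k + 1)) := by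
        have := Nat.choose_mul_succ_eq (n + 1) (k + 1)
        rw [show n + 1 + 1 - (k + 1) = n - k + 1 by omega] at this
        have h := congrArg (Nat.cast (R := ℝ)) this
        push_cast at h
        linarith
      rw [h2, derivative_X_sub_C_pow, Nat.add_sub_cancel]
      rw [← mul_assoc, ← mul_assoc, ← C_mul, ← C_mul]
      congr 2
      rw [← mul_assoc (_ + 2 : ℝ), ← h3]
      push_cast
      ring
    · have h0 := congrFun (fwdDiff_iter_pow_eq_zero_of_lt (R := ℝ) (Nat.lt_succ_self (n + 1))) 0
      rw [fwdDiff_iter_eq_sum_shift, Finset.sum_range_succ'] at h0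
      simp only [eval_finsetSum, eval_mul, eval_C, eval_pow, eval_sub, eval_X, zero_sub]
      rw [zero_pow (by omega), mul_zero]
      simp only [zero_add, Pi.zero_apply, nsmul_eq_mul, zsmul_eq_mul] at h0
      rw [Nat.cast_zero, zero_mul, zero_pow (by omega), mul_zero, add_zero] at h0
      rw [← h0]
      refine Finset.sum_congr rfl fun k hk => ?_
      have hk' : k ≤ n + 1 := by simpa [Nat.lt_succ_iff] using hk
      rw [neg_pow]
      have h4 : ((k : ℝ) + 1) ^ (n + 1) = (k + 1) ^ k * (k + 1) ^ (n + 1 - k) := by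
        rw [← pow_add]; congr 1; omega
      push_cast
      simp only [mul_one]
      rw [h4]
      ring

theorem sum_choose_mul_pow_mul_pow (n : ℕ) :
    ∑ k ∈ Finset.range (n + 1), ((n + 1).choose (k + 1) : ℝ) * ((k : ℝ) + 1) ^ k *
      ((n - k : ℕ) : ℝ) ^ (n - k) = ((n : ℝ) + 1) ^ (n + 1) := by
  have h := congrArg (Polynomial.eval ((n : ℝ) + 1)) (sum_choose_mul_pow_mul_X_sub_pow n)
  simp only [Polynomial.eval_finsetSum, Polynomial.eval_mul, Polynomial.eval_C,
    Polynomial.eval_pow, Polynomial.eval_sub, Polynomial.eval_X] at h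
  rw [pow_succ', ← h]
  refine Finset.sum_congr rfl fun k hk => ?_
  have hk' : k ≤ n := by simpa [Nat.lt_succ_iff] using hk
  rw [Nat.cast_sub hk']
  ring

/-- The exponential generating series of `k ^ k`. -/
noncomputable def powSelfSeries : PowerSeries ℝ :=
  PowerSeries.mk fun k => (k : ℝ) ^ k / (k.factorial : ℝ)

/-- The exponential generating series of `k ^ (k - 1)`, the number of rooted labelled trees. -/
noncomputable def rootedTreeSeries : PowerSeries ℝ :=
  PowerSeries.mk fun k => if k = 0 then 0 else (k : ℝ) ^ (k - 1) / (k.factorial : ℝ)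

theorem powSelfSeries_mul_rootedTreeSeries :
    rootedTreeSeries * powSelfSeries = powSelfSeries - 1 := by
  ext n
  rw [PowerSeries.coeff_mul]
  cases n with
  | zero => simp [powSelfSeries, rootedTreeSeries]
  | succ n =>
    rw [Finset.Nat.sum_antidiagonal_succ, Finset.Nat.sum_antidiagonal_eq_sum_range_succ_mk]
    simp only [powSelfSeries, rootedTreeSeries, PowerSeries.coeff_mk, map_sub, PowerSeries.coeff_one]
    simp only [if_true, zero_mul, zero_add, Nat.add_eq_zero_iff, one_ne_zero, and_false, if_false,
      sub_zero, Nat.add_sub_cancel]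
    have h := sum_choose_mul_pow_mul_pow n
    push_cast
    rw [← h, Finset.sum_div]
    refine Finset.sum_congr rfl fun k hk => ?_
    have hk' : k ≤ n := by simpa [Nat.lt_succ_iff] using hk
    have h3 : ((n + 1).choose (k + 1) : ℝ) = (n + 1).factorial / ((k + 1).factorial * (n - k).factorial) := by
      rw [Nat.cast_choose ℝ (by omega)]
      congr 3
      congr 1
      omega
    rw [h3]
    have h5 := Nat.factorial_ne_zero (n + 1)
    have h6 := Nat.factorial_ne_zero (k + 1)
    have h7 := Nat.factorial_ne_zero (n - k)
    field_simp

open PowerSeries in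
theorem X_mul_derivative_rootedTreeSeries :
    X * derivative ℝ rootedTreeSeries = powSelfSeries - 1 := by
  ext n
  cases n with
  | zero => simp [powSelfSeries]
  | succ n =>
    rw [coeff_succ_X_mul, coeff_derivative]
    simp only [powSelfSeries, rootedTreeSeries, coeff_mk, map_sub, coeff_one]
    simp
    field_simp
    ring

open PowerSeries in
theorem X_mul_derivative_powSelfSeries :
    X * derivative ℝ powSelfSeries = powSelfSeries ^ 3 - powSelfSeries ^ 2 := by
  have h1 := powSelfSeries_mul_rootedTreeSeries
  have h2 := X_mul_derivative_rootedTreeSeries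
  have h3 := congrArg (derivative ℝ) h1
  simp only [Derivation.leibniz, map_sub, Derivation.map_one_eq_zero, sub_zero, smul_eq_mul] at h3
  linear_combination powSelfSeries * powSelfSeries * h2 - X * powSelfSeries * h3
    + X * derivative ℝ powSelfSeries * h1

open PowerSeries in
theorem coeff_powSelfSeries_pow_three (m : ℕ) :
    coeff m (powSelfSeries ^ 3) =
      coeff m (powSelfSeries ^ 2) + m * ((m : ℝ) ^ m / (m.factorial : ℝ)) := by
  have h := congrArg (coeff m) X_mul_derivative_powSelfSeries
  rw [map_sub] at h
  rw [← sub_eq_iff_eq_add', ← h]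
  cases m with
  | zero => simp
  | succ n =>
    rw [coeff_succ_X_mul, coeff_derivative, powSelfSeries, coeff_mk]
    push_cast
    ring

theorem sum_fun_fin_three_prod_count (f : ℕ → ℝ) (m : ℕ) :
    ∑ v : Fin m → Fin 3, ∏ c, f (Finset.card {k | v k = c}) =
      ∑ p ∈ Finset.HasAntidiagonal.antidiagonal m, (m.choose p.1 : ℝ) * (f p.1 *
        ∑ q ∈ Finset.HasAntidiagonal.antidiagonal p.2, (p.2.choose q.1 : ℝ) * (f q.1 * f q.2)) := by
  let b := MvPolynomial.basisMonomials (Fin 3) ℝ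
  let Λ : MvPolynomial (Fin 3) ℝ →ₗ[ℝ] ℝ := b.constr ℝ fun n => ∏ c, f (n c)
  have hΛ : ∀ n : Fin 3 →₀ ℕ, Λ (MvPolynomial.monomial n 1) = ∏ c, f (n c) := by
    intro n
    have := b.constr_basis ℝ (fun n : Fin 3 →₀ ℕ => ∏ c, f (n c)) n
    simpa [b, MvPolynomial.coe_basisMonomials] using this
  have h1 : ∑ v : Fin m → Fin 3, ∏ c, f (Finset.card {k | v k = c}) =
      Λ ((∑ c, MvPolynomial.X c) ^ m) := by
    rw [Fintype.sum_pow, map_sum]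
    refine Finset.sum_congr rfl fun v _ => ?_
    have h2 : ∏ i, (MvPolynomial.X (v i) : MvPolynomial (Fin 3) ℝ) =
        MvPolynomial.monomial (∑ i, Finsupp.single (v i) 1) 1 := by
      rw [MvPolynomial.monomial_sum_one]
      rfl
    rw [h2, hΛ]
    refine Finset.prod_congr rfl fun c _ => ?_
    congr 1
    rw [Finsupp.finsetSum_apply, Finset.card_filter]
    refine Finset.sum_congr rfl fun i _ => ?_
    rw [Finsupp.single_apply]
  rw [h1, Fin.sum_univ_three, add_assoc, (Commute.all _ _).add_pow', map_sum]
  refine Finset.sum_congr rfl fun p _ => ?_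
  rw [(Commute.all _ _).add_pow', map_nsmul, Finset.mul_sum, map_sum, nsmul_eq_mul]
  congr 1
  rw [Finset.mul_sum]
  refine Finset.sum_congr rfl fun q _ => ?_
  rw [mul_smul_comm, map_nsmul, nsmul_eq_mul]
  have h3 : (MvPolynomial.X 0 ^ p.1 * (MvPolynomial.X 1 ^ q.1 * MvPolynomial.X 2 ^ q.2) :
      MvPolynomial (Fin 3) ℝ) = MvPolynomial.monomial
        (Finsupp.single 0 p.1 + (Finsupp.single 1 q.1 + Finsupp.single 2 q.2)) 1 := by
    simp [MvPolynomial.X_pow_eq_monomial, MvPolynomial.monomial_mul]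
  rw [h3, hΛ, Fin.prod_univ_three]
  simp
  ring

theorem coeff_powSelfSeries_sq (n : ℕ) :
    (n.factorial : ℝ) * PowerSeries.coeff n (powSelfSeries ^ 2) =
      ∑ q ∈ Finset.HasAntidiagonal.antidiagonal n, (n.choose q.1 : ℝ) * ((q.1 : ℝ) ^ q.1 * (q.2 : ℝ) ^ q.2) := by
  rw [sq, PowerSeries.coeff_mul, Finset.mul_sum]
  refine Finset.sum_congr rfl fun q hq => ?_
  obtain rfl := Finset.HasAntidiagonal.mem_antidiagonal.mp hq
  rw [Nat.cast_add_choose, powSelfSeries, PowerSeries.coeff_mk, PowerSeries.coeff_mk]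
  field_simp

theorem sum_fun_fin_three_prod_pow_count {m : ℕ} (hm : 0 < m) :
    ∑ v : Fin m → Fin 3, ∏ c : Fin 3,
      ((Finset.card {k | v k = c} : ℝ) / m) ^ (Finset.card {k | v k = c}) = xi m + m := by
  have hm0 : (m : ℝ) ≠ 0 := by positivity
  rw [sum_fun_fin_three_prod_count (fun k => ((k : ℝ) / m) ^ k) m]
  have h3 : ∑ p ∈ Finset.HasAntidiagonal.antidiagonal m, (m.choose p.1 : ℝ) * (((p.1 : ℝ) / m) ^ p.1 *
        ∑ q ∈ Finset.HasAntidiagonal.antidiagonal p.2, (p.2.choose q.1 : ℝ) *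
          (((q.1 : ℝ) / m) ^ q.1 * ((q.2 : ℝ) / m) ^ q.2)) =
      (m.factorial : ℝ) / m ^ m * PowerSeries.coeff m (powSelfSeries ^ 3) := by
    rw [pow_succ', PowerSeries.coeff_mul, Finset.mul_sum]
    refine Finset.sum_congr rfl fun p hp => ?_
    have hp' := Finset.HasAntidiagonal.mem_antidiagonal.mp hp
    have h4 : ∑ q ∈ Finset.HasAntidiagonal.antidiagonal p.2, (p.2.choose q.1 : ℝ) *
          (((q.1 : ℝ) / m) ^ q.1 * ((q.2 : ℝ) / m) ^ q.2) =
        (p.2.factorial : ℝ) * PowerSeries.coeff p.2 (powSelfSeries ^ 2) / m ^ p.2 := by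
      rw [coeff_powSelfSeries_sq, Finset.sum_div]
      refine Finset.sum_congr rfl fun q hq => ?_
      rw [← Finset.HasAntidiagonal.mem_antidiagonal.mp hq, pow_add, div_pow, div_pow]
      field_simp
    have h5 : (m.choose p.1 : ℝ) = m.factorial / (p.1.factorial * p.2.factorial) := by
      rw [← hp', Nat.cast_add_choose]
    have h6 : (m : ℝ) ^ m = m ^ p.1 * m ^ p.2 := by rw [← pow_add, hp']
    rw [h4, h5, h6, div_pow, powSelfSeries, PowerSeries.coeff_mk]
    have := Nat.factorial_ne_zero p.1
    have := Nat.factorial_ne_zero p.2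
    field_simp
  have h2 : xi m = (m.factorial : ℝ) / m ^ m * PowerSeries.coeff m (powSelfSeries ^ 2) := by
    rw [div_mul_eq_mul_div, coeff_powSelfSeries_sq, xi, Finset.sum_div,
      Finset.Nat.sum_antidiagonal_eq_sum_range_succ_mk]
    refine Finset.sum_congr rfl fun k hk => ?_
    have hk' : k ≤ m := by simpa [Nat.lt_succ_iff] using hk
    have h6 : (m : ℝ) ^ m = m ^ k * m ^ (m - k) := by rw [← pow_add]; congr 1; omega
    have h7 : 1 - (k : ℝ) / m = ((m - k : ℕ) : ℝ) / m := by
      rw [Nat.cast_sub hk']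
      field_simp
    simp only
    rw [h6, h7, div_pow, div_pow]
    field_simp
  rw [h3, coeff_powSelfSeries_pow_three, mul_add, ← h2]
  have := Nat.factorial_ne_zero m
  field_simp

theorem prod_pow_le_prod_div_pow {ι : Type*} [Fintype ι] {m : ℕ} (hm : 0 < m)
    (q : ι → ℝ) (hq : ∀ c, 0 ≤ q c) (hq1 : ∑ c, q c = 1) (n : ι → ℕ) (hn : ∑ c, n c = m) :
    ∏ c, q c ^ n c ≤ ∏ c, ((n c : ℝ) / m) ^ n c := by
  have hm0 : (0 : ℝ) < m := by exact_mod_cast hm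
  have h1 : ∀ c, q c ^ n c ≤ ((n c : ℝ) / m) ^ n c * Real.exp (m * q c - n c) := by
    intro c
    rcases Nat.eq_zero_or_pos (n c) with h | h
    · simp [h, mul_nonneg hm0.le (hq c)]
    · have hn0 : (0 : ℝ) < n c := by exact_mod_cast h
      have h2 : m * q c - n c = n c * (m * q c / n c - 1) := by field_simp
      rw [h2, Real.exp_nat_mul, ← mul_pow]
      refine pow_le_pow_left₀ (hq c) ?_ _
      have h3 := Real.add_one_le_exp (m * q c / n c - 1)
      calc q c = (n c / m) * (m * q c / n c) := by field_simp
        _ ≤ _ := by gcongr; linarith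
  calc ∏ c, q c ^ n c ≤ ∏ c, ((n c : ℝ) / m) ^ n c * Real.exp (m * q c - n c) :=
        Finset.prod_le_prod (fun c _ => pow_nonneg (hq c) _) fun c _ => h1 c
    _ = ∏ c, ((n c : ℝ) / m) ^ n c := by
        rw [Finset.prod_mul_distrib, ← Real.exp_sum, Finset.sum_sub_distrib, ← Finset.mul_sum, hq1,
          ← Nat.cast_sum, hn]
        simp

/-- A multilinear function of the points `x k` of the simplex that dominates
`exp (m * kl(q ‖ p))`, where `q` is the mean of the `x k`. -/
noncomputable def multinomialMajorant {m : ℕ} (p : Fin 3 → ℝ) (x : Fin m → Fin 3 → ℝ) : ENNReal :=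
  ∑ v : Fin m → Fin 3, (∏ k, ENNReal.ofReal (x k (v k))) *
    ∏ c, (ENNReal.ofReal ((Finset.card {k | v k = c} : ℝ) / m) / ENNReal.ofReal (p c)) ^
      (Finset.card {k | v k = c})

theorem mul_add_one_sub_mul_exp_le {q p s : ℝ} (hq : 0 ≤ q) (hp : 0 < p) :
    q * (s + 1) - p * Real.exp s ≤ q * Real.log (q / p) := by
  rcases hq.eq_or_lt with rfl | hq
  · simp only [zero_mul, zero_sub, neg_nonpos]
    positivity
  · have h1 := Real.add_one_le_exp (s - Real.log (q / p))
    rw [Real.exp_sub, Real.exp_log (by positivity)] at h1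
    have h2 := mul_le_mul_of_nonneg_left h1 hq.le
    have h3 : q * (Real.exp s / (q / p)) = p * Real.exp s := by field_simp
    linarith

theorem exp_le_multinomialMajorant {m : ℕ} (hm : 0 < m) (p : Fin 3 → ℝ) (hp : ∀ c, 0 ≤ p c)
    (x : Fin m → Fin 3 → ℝ) (hx : ∀ k c, 0 ≤ x k c) (hx1 : ∀ k, ∑ c, x k c = 1) (s : Fin 3 → ℝ) :
    ENNReal.ofReal (Real.exp (m * ∑ c, (((m : ℝ)⁻¹ * ∑ k, x k c) * (s c + 1)
      - p c * Real.exp (s c)))) ≤ multinomialMajorant p x := by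
  have hm0 : (0 : ℝ) < m := by exact_mod_cast hm
  set q : Fin 3 → ℝ := fun c => (m : ℝ)⁻¹ * ∑ k, x k c with hqdef
  have hq : ∀ c, 0 ≤ q c := fun c =>
    mul_nonneg (by positivity) (Finset.sum_nonneg fun k _ => hx k c)
  have hq1 : ∑ c, q c = 1 := by
    simp only [hqdef]
    rw [← Finset.mul_sum, Finset.sum_comm, Finset.sum_congr rfl fun k _ => hx1 k]
    simp [hm0.ne']
  set t : Fin 3 → ℝ := fun c => if p c = 0 then s c + 1 else Real.log (q c / p c) with ht
  have h1 : ∀ c, q c * (s c + 1) - p c * Real.exp (s c) ≤ q c * t c := by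
    intro c
    by_cases h : p c = 0
    · simp [ht, h]
    · simp only [ht, h, if_false]
      exact mul_add_one_sub_mul_exp_le (hq c) (lt_of_le_of_ne (hp c) (Ne.symm h))
  have h2 : (m : ℝ) * ∑ c, q c * t c = ∑ k, ∑ c, x k c * t c := by
    rw [Finset.sum_comm, Finset.mul_sum]
    refine Finset.sum_congr rfl fun c _ => ?_
    rw [← Finset.sum_mul, ← mul_assoc]
    simp only [hqdef]
    rw [mul_inv_cancel_left₀ hm0.ne']
  have h3 : Real.exp (m * ∑ c, (q c * (s c + 1) - p c * Real.exp (s c))) ≤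
      ∏ k, ∑ c, x k c * Real.exp (t c) := by
    calc _ ≤ Real.exp (m * ∑ c, q c * t c) := by
          gcongr with c
          exact h1 c
      _ = ∏ k, Real.exp (∑ c, x k c * t c) := by rw [h2, Real.exp_sum]
      _ ≤ _ := by
          refine Finset.prod_le_prod (fun k _ => (Real.exp_pos _).le) fun k _ => ?_
          exact convexOn_exp.map_sum_le (fun c _ => hx k c) (hx1 k) fun c _ => Set.mem_univ (t c)
  have h4 : ∀ k c, ENNReal.ofReal (x k c * Real.exp (t c)) ≤
      ENNReal.ofReal (x k c) * (ENNReal.ofReal (q c) / ENNReal.ofReal (p c)) := by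
    intro k c
    rcases (hx k c).eq_or_lt with h | h
    · simp [← h]
    · have hqc : 0 < q c := by
        refine mul_pos (by positivity) (Finset.sum_pos' (fun k _ => hx k c) ⟨k, Finset.mem_univ k, h⟩)
      rw [ENNReal.ofReal_mul (hx k c)]
      gcongr
      by_cases hpc : p c = 0
      · rw [hpc, ENNReal.ofReal_zero, ENNReal.div_zero (by simpa using hqc)]
        exact le_top
      · have hpc' : 0 < p c := lt_of_le_of_ne (hp c) (Ne.symm hpc)
        simp only [ht, hpc, if_false]
        rw [Real.exp_log (by positivity), ENNReal.ofReal_div_of_pos hpc']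
  calc _ ≤ ENNReal.ofReal (∏ k, ∑ c, x k c * Real.exp (t c)) := ENNReal.ofReal_le_ofReal h3
    _ = ∏ k, ∑ c, ENNReal.ofReal (x k c * Real.exp (t c)) := by
        have h5 : ∀ k c, 0 ≤ x k c * Real.exp (t c) := fun k c =>
          mul_nonneg (hx k c) (Real.exp_pos _).le
        rw [ENNReal.ofReal_prod_of_nonneg fun k _ => Finset.sum_nonneg fun c _ => h5 k c]
        exact Finset.prod_congr rfl fun k _ => ENNReal.ofReal_sum_of_nonneg fun c _ => h5 k c
    _ ≤ ∏ k, ∑ c, ENNReal.ofReal (x k c) * (ENNReal.ofReal (q c) / ENNReal.ofReal (p c)) := by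
        gcongr with k _ c
        exact h4 k c
    _ ≤ multinomialMajorant p x := by
        rw [Fintype.prod_sum]
        refine Finset.sum_le_sum fun v _ => ?_
        rw [Finset.prod_mul_distrib]
        refine mul_le_mul_right ?_ _
        have h6 : ∏ k, (ENNReal.ofReal (q (v k)) / ENNReal.ofReal (p (v k))) =
            ∏ c, (ENNReal.ofReal (q c) / ENNReal.ofReal (p c)) ^
              (Finset.card {k | v k = c}) := by
          rw [← Finset.prod_fiberwise (s := Finset.univ) (g := v)]
          refine Finset.prod_congr rfl fun c _ => ?_
          rw [Finset.prod_congr rfl (g := fun _ => ENNReal.ofReal (q c) / ENNReal.ofReal (p c)),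
            Finset.prod_const]
          intro k hk
          rw [(Finset.mem_filter.mp hk).2]
        rw [h6]
        simp only [div_eq_mul_inv (ENNReal.ofReal _), mul_pow, Finset.prod_mul_distrib]
        gcongr ?_ * _
        simp only [← ENNReal.ofReal_pow (hq _),
          ← ENNReal.ofReal_pow (div_nonneg (Nat.cast_nonneg _) hm0.le)]
        rw [← ENNReal.ofReal_prod_of_nonneg fun c _ => pow_nonneg (hq c) _,
          ← ENNReal.ofReal_prod_of_nonneg fun c _ => by positivity]
        refine ENNReal.ofReal_le_ofReal (prod_pow_le_prod_div_pow hm q hq hq1 _ ?_)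
        rw [← Finset.card_eq_sum_card_fiberwise fun k _ => Finset.mem_coe.mpr (Finset.mem_univ (v k))]
        simp

theorem lintegral_multinomialMajorant_le {Z : Type*} [MeasurableSpace Z] (D : Measure Z)
    [IsProbabilityMeasure D] {m : ℕ} (hm : 0 < m) (g : Fin 3 → Z → ℝ)
    (hg : ∀ c, Integrable (g c) D) (hgm : ∀ c, Measurable (g c)) (hg0 : ∀ c z, 0 ≤ g c z) :
    ∫⁻ S, multinomialMajorant (fun c => ∫ z, g c z ∂D) (fun k c => g c (S k))
      ∂(Measure.pi fun _ : Fin m => D) ≤ ENNReal.ofReal (xi m + m) := by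
  have hm0 : (0 : ℝ) < m := by exact_mod_cast hm
  unfold multinomialMajorant
  rw [lintegral_finsetSum _ fun v _ => by fun_prop, ← sum_fun_fin_three_prod_pow_count hm,
    ENNReal.ofReal_sum_of_nonneg fun v _ => by positivity]
  refine Finset.sum_le_sum fun v _ => ?_
  rw [lintegral_mul_const _ (by fun_prop),
    ProbabilityTheory.lintegral_prod_eq_prod_lintegral_of_indepFun Finset.univ
      (fun k (S : Fin m → Z) => ENNReal.ofReal (g (v k) (S k)))
      (ProbabilityTheory.iIndepFun_pi (X := fun k z => ENNReal.ofReal (g (v k) z))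
        fun k => by fun_prop) (fun k => by fun_prop)]
  have h1 : ∀ k, ∫⁻ S : Fin m → Z, ENNReal.ofReal (g (v k) (S k)) ∂(Measure.pi fun _ => D) =
      ENNReal.ofReal (∫ z, g (v k) z ∂D) := by
    intro k
    rw [ofReal_integral_eq_lintegral_ofReal (hg _) (Filter.Eventually.of_forall (hg0 _))]
    exact (measurePreserving_eval (fun _ : Fin m => D) k).lintegral_comp
      (f := fun z => ENNReal.ofReal (g (v k) z)) (by fun_prop)
  rw [Finset.prod_congr rfl fun k _ => h1 k]
  rw [← Finset.prod_fiberwise (s := Finset.univ) (g := v), ← Finset.prod_mul_distrib,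
    ENNReal.ofReal_prod_of_nonneg fun c _ => by positivity]
  refine Finset.prod_le_prod' fun c _ => ?_
  rw [Finset.prod_congr rfl (g := fun _ => ENNReal.ofReal (∫ z, g c z ∂D)), Finset.prod_const,
    ← mul_pow, ENNReal.ofReal_pow (by positivity)]
  · gcongr
    exact ENNReal.mul_div_le
  · intro k hk
    rw [(Finset.mem_filter.mp hk).2]

/-- **Donsker–Varadhan** change of measure for bounded functions. -/
theorem integral_le_integral_llr_add_log {J : Type*} [MeasurableSpace J] {ρ ν : Measure J}
    [IsProbabilityMeasure ρ] [IsProbabilityMeasure ν] (hρ : ρ ≪ ν) (hint : Integrable (llr ρ ν) ρ)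
    {f : J → ℝ} (hf : Measurable f) {K : ℝ} (hK : ∀ j, |f j| ≤ K) {B : ℝ} (hB : 0 < B)
    (hfB : ∫⁻ j, ENNReal.ofReal (Real.exp (f j)) ∂ν ≤ ENNReal.ofReal B) :
    ∫ j, f j ∂ρ ≤ ∫ j, llr ρ ν j ∂ρ + Real.log B := by
  have hfρ : Integrable f ρ :=
    Integrable.of_bound hf.aestronglyMeasurable K (Filter.Eventually.of_forall hK)
  have hexp : Integrable (fun j => Real.exp (f j)) ν := by
    refine Integrable.of_bound (by fun_prop) (Real.exp K) (Filter.Eventually.of_forall fun j => ?_)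
    rw [Real.norm_eq_abs, abs_of_pos (Real.exp_pos _)]
    exact Real.exp_le_exp.mpr ((le_abs_self _).trans (hK j))
  have := isProbabilityMeasure_tilted hexp
  have h1 := InformationTheory.integral_llr_add_sub_measure_univ_nonneg
    (hρ.trans (absolutelyContinuous_tilted hexp))
    (integrable_llr_tilted_right hρ hfρ hint hexp)
  rw [integral_llr_tilted_right hρ hfρ hexp hint] at h1
  simp only [probReal_univ] at h1
  have h2 : ∫ j, Real.exp (f j) ∂ν ≤ B := by
    rw [← ofReal_integral_eq_lintegral_ofReal hexp
      (Filter.Eventually.of_forall fun j => (Real.exp_pos _).le)] at hfB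
    exact (ENNReal.ofReal_le_ofReal_iff hB.le).mp hfB
  have h3 := Real.log_le_log (integral_exp_pos hexp) h2
  linarith

theorem llr_prod_self {ι : Type*} [MeasurableSpace ι] {Q P : Measure ι}
    [IsProbabilityMeasure Q] [IsProbabilityMeasure P] (hQP : Q ≪ P) :
    llr (Q.prod Q) (P.prod P) =ᵐ[Q.prod Q] fun z => llr Q P z.1 + llr Q P z.2 := by
  have h1 : Q.prod Q = (P.prod P).withDensity fun z => Q.rnDeriv P z.1 * Q.rnDeriv P z.2 := by
    rw [← prod_withDensity (Measure.measurable_rnDeriv Q P) (Measure.measurable_rnDeriv Q P),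
      Measure.withDensity_rnDeriv_eq Q P hQP]
  have h2 : (Q.prod Q).rnDeriv (P.prod P) =ᵐ[P.prod P]
      fun z => Q.rnDeriv P z.1 * Q.rnDeriv P z.2 := by
    conv_lhs => rw [h1]
    exact Measure.rnDeriv_withDensity _ (by fun_prop)
  have h3 : ∀ᵐ i ∂Q, 0 < Q.rnDeriv P i ∧ Q.rnDeriv P i < ⊤ :=
    (Measure.rnDeriv_pos hQP).and (hQP.ae_le (Measure.rnDeriv_lt_top Q P))
  filter_upwards [(hQP.prod hQP).ae_le h2, Measure.quasiMeasurePreserving_fst.ae h3,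
    Measure.quasiMeasurePreserving_snd.ae h3] with z hz hz1 hz2
  simp only [llr]
  rw [hz, ENNReal.toReal_mul, Real.log_mul
    (ENNReal.toReal_pos hz1.1.ne' hz1.2.ne).ne' (ENNReal.toReal_pos hz2.1.ne' hz2.2.ne).ne']

theorem integrable_llr_prod_self {ι : Type*} [MeasurableSpace ι] {Q P : Measure ι}
    [IsProbabilityMeasure Q] [IsProbabilityMeasure P] (hQP : Q ≪ P)
    (hint : Integrable (llr Q P) Q) : Integrable (llr (Q.prod Q) (P.prod P)) (Q.prod Q) := by
  rw [integrable_congr (llr_prod_self hQP)]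
  exact (hint.comp_fst Q).add (hint.comp_snd Q)

theorem integral_llr_prod_self {ι : Type*} [MeasurableSpace ι] {Q P : Measure ι}
    [IsProbabilityMeasure Q] [IsProbabilityMeasure P] (hQP : Q ≪ P)
    (hint : Integrable (llr Q P) Q) :
    ∫ z, llr (Q.prod Q) (P.prod P) z ∂(Q.prod Q) = 2 * ∫ i, llr Q P i ∂Q := by
  rw [integral_congr_ae (llr_prod_self hQP),
    integral_add (hint.comp_fst Q) (hint.comp_snd Q), integral_fun_fst, integral_fun_snd]
  simp only [probReal_univ, one_smul]
  ring

theorem sum_mul_log_div_le_of_forall {m : ℕ} (hm : 0 < m) {a b : Fin 3 → ℝ} (ha : ∀ c, 0 ≤ a c)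
    (hb : ∀ c, 0 ≤ b c) (hb1 : ∀ c, b c ≤ 1) {B : ℝ}
    (h : ∀ s : Fin 3 → ℝ, m * ∑ c, (a c * (s c + 1) - b c * Real.exp (s c)) ≤ B) :
    ∑ c, a c * Real.log (a c / b c) ≤ (m : ℝ)⁻¹ * B := by
  have hm0 : (0 : ℝ) < m := by exact_mod_cast hm
  refine le_of_forall_pos_le_add fun η hη => ?_
  have h1 := h fun c => if a c = 0 then Real.log (η / 3) else Real.log (a c / b c)
  rw [← le_div_iff₀' hm0, div_eq_inv_mul B] at h1
  have h2 : ∀ c, a c * Real.log (a c / b c) - η / 3 ≤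
      a c * ((if a c = 0 then Real.log (η / 3) else Real.log (a c / b c)) + 1) -
        b c * Real.exp (if a c = 0 then Real.log (η / 3) else Real.log (a c / b c)) := by
    intro c
    by_cases hac : a c = 0
    · simp only [hac, if_true, zero_mul, zero_sub]
      rw [Real.exp_log (by positivity)]
      have := mul_le_mul_of_nonneg_right (hb1 c) (by positivity : 0 ≤ η / 3)
      linarith
    · have hac' : 0 < a c := lt_of_le_of_ne (ha c) (Ne.symm hac)
      simp only [hac, if_false]
      rcases (hb c).eq_or_lt with hbc | hbc
      · simp only [← hbc, div_zero, Real.log_zero]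
        linarith
      · rw [Real.exp_log (by positivity), mul_div_cancel₀ _ hbc.ne']
        linarith
  have h3 := Finset.sum_le_sum fun c (_ : c ∈ Finset.univ) => h2 c
  rw [Finset.sum_sub_distrib] at h3
  simp only [Finset.sum_const, Finset.card_univ, Fintype.card_fin, nsmul_eq_mul] at h3
  push_cast at h3
  linarith

theorem ofReal_one_sub_le_measure_lintegral_multinomialMajorant_lt {Z J : Type*}
    [MeasurableSpace Z] [MeasurableSpace J] (D : Measure Z) [IsProbabilityMeasure D]
    (ν : Measure J) [IsProbabilityMeasure ν] {m : ℕ} (hm : 0 < m) {δ : ℝ} (hδ : 0 < δ)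
    (G : Fin 3 → J → Z → ℝ) (hG : ∀ c, Measurable (Function.uncurry (G c)))
    (hG0 : ∀ c j z, 0 ≤ G c j z) (hG1 : ∀ c j z, G c j z ≤ 1) :
    ENNReal.ofReal (1 - δ) ≤ (Measure.pi fun _ : Fin m => D)
      {S | ∫⁻ j, multinomialMajorant (fun c => ∫ z, G c j z ∂D) (fun k c => G c j (S k)) ∂ν
        < ENNReal.ofReal ((xi m + m) / δ)} := by
  have hm0 : (0 : ℝ) < m := by exact_mod_cast hm
  have hξ : 0 < xi m + m := by
    have : (0 : ℝ) ≤ xi m := by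
      refine Finset.sum_nonneg fun k hk => ?_
      have hk' : (k : ℝ) ≤ m := by exact_mod_cast Nat.lt_succ_iff.mp (Finset.mem_range.mp hk)
      have : 0 ≤ 1 - (k : ℝ) / m := by rw [sub_nonneg, div_le_one hm0]; exact hk'
      positivity
    positivity
  have hGj : ∀ c j, Measurable (G c j) := fun c j => (hG c).comp measurable_prodMk_left
  have hGi : ∀ c j, Integrable (G c j) D := fun c j =>
    Integrable.of_bound (hGj c j).aestronglyMeasurable 1 (Filter.Eventually.of_forall fun z => by
      rw [Real.norm_eq_abs, abs_of_nonneg (hG0 c j z)]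
      exact hG1 c j z)
  have hp : ∀ c, Measurable fun j => ∫ z, G c j z ∂D := fun c =>
    ((hG c).stronglyMeasurable.integral_prod_right).measurable
  have hmeas : Measurable fun y : (Fin m → Z) × J =>
      multinomialMajorant (fun c => ∫ z, G c y.2 z ∂D) (fun k c => G c y.2 (y.1 k)) := by
    unfold multinomialMajorant
    have hGS : ∀ c k, Measurable fun y : (Fin m → Z) × J => G c y.2 (y.1 k) := fun c k =>
      (hG c).comp (measurable_snd.prodMk ((measurable_pi_apply k).comp measurable_fst))
    have hp' : ∀ c, Measurable fun y : (Fin m → Z) × J => ∫ z, G c y.2 z ∂D := fun c =>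
      (hp c).comp measurable_snd
    refine Finset.measurable_fun_sum _ fun v _ => Measurable.mul ?_ ?_
    · exact Finset.measurable_fun_prod _ fun k _ => (hGS _ k).ennreal_ofReal
    · exact Finset.measurable_fun_prod _ fun c _ =>
        ((hp' c).ennreal_ofReal.const_div _).pow_const _
  set Ψ : (Fin m → Z) → ENNReal := fun S =>
    ∫⁻ j, multinomialMajorant (fun c => ∫ z, G c j z ∂D) (fun k c => G c j (S k)) ∂ν with hΨ
  have hΨm : Measurable Ψ := hmeas.lintegral_prod_right'
  have h1 : ∫⁻ S, Ψ S ∂(Measure.pi fun _ : Fin m => D) ≤ ENNReal.ofReal (xi m + m) := by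
    rw [hΨ, lintegral_lintegral_swap hmeas.aemeasurable]
    calc _ ≤ ∫⁻ _, ENNReal.ofReal (xi m + m) ∂ν := lintegral_mono fun j =>
          lintegral_multinomialMajorant_le D hm (fun c => G c j) (fun c => hGi c j)
            (fun c => hGj c j) (fun c => hG0 c j)
      _ = _ := by simp
  have h2 : (Measure.pi fun _ : Fin m => D) {S | ENNReal.ofReal ((xi m + m) / δ) ≤ Ψ S} ≤
      ENNReal.ofReal δ := by
    have h3 := (mul_meas_ge_le_lintegral hΨm (ENNReal.ofReal ((xi m + m) / δ))).trans h1
    rw [show xi m + m = (xi m + m) / δ * δ by field_simp, mul_div_cancel_right₀ _ hδ.ne',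
      ENNReal.ofReal_mul (by positivity)] at h3
    exact (ENNReal.mul_le_mul_iff_right (by simpa using by positivity) ENNReal.ofReal_ne_top).mp h3
  have h4 : {S | Ψ S < ENNReal.ofReal ((xi m + m) / δ)} =
      {S | ENNReal.ofReal ((xi m + m) / δ) ≤ Ψ S}ᶜ := by
    ext S
    simp
  rw [h4, prob_compl_eq_one_sub (measurableSet_le measurable_const hΨm),
    ENNReal.ofReal_sub _ hδ.le, ENNReal.ofReal_one]
  exact tsub_le_tsub_left h2 _

theorem sum_mul_log_div_le_of_lintegral_multinomialMajorant_le {Z J : Type*}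
    [MeasurableSpace Z] [MeasurableSpace J] (D : Measure Z) [IsProbabilityMeasure D]
    {ρ ν : Measure J} [IsProbabilityMeasure ρ] [IsProbabilityMeasure ν] (hρ : ρ ≪ ν)
    (hint : Integrable (llr ρ ν) ρ) {m : ℕ} (hm : 0 < m) {B : ℝ} (hB : 0 < B)
    (G : Fin 3 → J → Z → ℝ) (hG : ∀ c, Measurable (Function.uncurry (G c)))
    (hG0 : ∀ c j z, 0 ≤ G c j z) (hG1 : ∀ j z, ∑ c, G c j z = 1) (S : Fin m → Z)
    (hS : ∫⁻ j, multinomialMajorant (fun c => ∫ z, G c j z ∂D) (fun k c => G c j (S k)) ∂ν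
        ≤ ENNReal.ofReal B) :
    ∑ c, ((m : ℝ)⁻¹ * ∑ k, ∫ j, G c j (S k) ∂ρ) *
        Real.log (((m : ℝ)⁻¹ * ∑ k, ∫ j, G c j (S k) ∂ρ) / ∫ j, ∫ z, G c j z ∂D ∂ρ) ≤
      (m : ℝ)⁻¹ * (∫ j, llr ρ ν j ∂ρ + Real.log B) := by
  have hm0 : (0 : ℝ) < m := by exact_mod_cast hm
  have hGle : ∀ c j z, G c j z ≤ 1 := fun c j z => by
    rw [← hG1 j z]
    exact Finset.single_le_sum (fun c _ => hG0 c j z) (Finset.mem_univ c)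
  have hGz : ∀ c z, Measurable fun j => G c j z := fun c z => (hG c).comp measurable_prodMk_right
  have hGzi : ∀ c z, Integrable (fun j => G c j z) ρ := fun c z =>
    Integrable.of_bound (hGz c z).aestronglyMeasurable 1 (Filter.Eventually.of_forall fun j => by
      rw [Real.norm_eq_abs, abs_of_nonneg (hG0 c j z)]
      exact hGle c j z)
  have hp : ∀ c, Measurable fun j => ∫ z, G c j z ∂D := fun c =>
    ((hG c).stronglyMeasurable.integral_prod_right).measurable
  have hp0 : ∀ c j, 0 ≤ ∫ z, G c j z ∂D := fun c j => integral_nonneg (hG0 c j)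
  have hp1 : ∀ c j, ∫ z, G c j z ∂D ≤ 1 := fun c j => by
    have := integral_mono_of_nonneg (μ := D) (Filter.Eventually.of_forall (hG0 c j))
      (integrable_const (1 : ℝ)) (Filter.Eventually.of_forall (hGle c j))
    simpa using this
  have hpi : ∀ c, Integrable (fun j => ∫ z, G c j z ∂D) ρ := fun c =>
    Integrable.of_bound (hp c).aestronglyMeasurable 1 (Filter.Eventually.of_forall fun j => by
      rw [Real.norm_eq_abs, abs_of_nonneg (hp0 c j)]
      exact hp1 c j)
  refine sum_mul_log_div_le_of_forall hm
    (fun c => mul_nonneg (by positivity) (Finset.sum_nonneg fun k _ => integral_nonneg fun j => hG0 c j _))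
    (fun c => integral_nonneg (hp0 c)) (fun c => ?_) fun s => ?_
  · have := integral_mono (hpi c) (integrable_const (1 : ℝ)) (hp1 c)
    simpa using this
  · set f : J → ℝ := fun j => m * ∑ c, (((m : ℝ)⁻¹ * ∑ k, G c j (S k)) * (s c + 1)
      - (∫ z, G c j z ∂D) * Real.exp (s c)) with hf
    have hterm : ∀ c, Integrable (fun j => ((m : ℝ)⁻¹ * ∑ k, G c j (S k)) * (s c + 1)) ρ :=
      fun c => ((integrable_finsetSum _ fun k _ => hGzi c (S k)).const_mul _).mul_const _
    have hfint : ∫ j, f j ∂ρ = m * ∑ c, (((m : ℝ)⁻¹ * ∑ k, ∫ j, G c j (S k) ∂ρ) * (s c + 1)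
        - (∫ j, ∫ z, G c j z ∂D ∂ρ) * Real.exp (s c)) := by
      rw [hf, integral_const_mul]
      congr 1
      refine (integral_finsetSum _ fun c _ => (hterm c).sub ((hpi c).mul_const _)).trans ?_
      refine Finset.sum_congr rfl fun c _ => ?_
      rw [integral_sub' (hterm c) ((hpi c).mul_const _), integral_mul_const, integral_mul_const,
        integral_const_mul, integral_finsetSum _ fun k _ => hGzi c (S k)]
    have hfm : Measurable f := by
      refine Measurable.const_mul (Finset.measurable_fun_sum _ fun c _ => ?_) _
      exact (((Finset.measurable_fun_sum _ fun k _ => hGz c (S k)).const_mul _).mul_const _).sub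
        ((hp c).mul_const _)
    have hfb : ∀ j, |f j| ≤ m * ∑ c, (|s c + 1| + Real.exp (s c)) := by
      intro j
      rw [hf, abs_mul, abs_of_pos hm0]
      gcongr
      refine (Finset.abs_sum_le_sum_abs _ _).trans (Finset.sum_le_sum fun c _ => ?_)
      refine (abs_sub _ _).trans (add_le_add ?_ ?_)
      · rw [abs_mul]
        refine mul_le_of_le_one_left (abs_nonneg _) ?_
        rw [abs_of_nonneg (mul_nonneg (by positivity) (Finset.sum_nonneg fun k _ => hG0 c j _)),
          inv_mul_le_one₀ hm0]
        refine (Finset.sum_le_sum fun k _ => hGle c j (S k)).trans ?_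
        simp
      · rw [abs_mul, abs_of_pos (Real.exp_pos _), abs_of_nonneg (hp0 c j)]
        exact mul_le_of_le_one_left (Real.exp_pos _).le (hp1 c j)
    rw [← hfint]
    refine integral_le_integral_llr_add_log hρ hint hfm hfb hB (le_trans ?_ hS)
    exact lintegral_mono fun j => exp_le_multinomialMajorant hm _ (fun c => hp0 c j) _
      (fun k c => hG0 c j (S k)) (fun k => hG1 j (S k)) s

/-- The paired losses giving the disagreement, the joint error and the joint success. -/
def IsPairedLoss (ℓ : ℝ → ℝ → ℝ → ℝ) : Prop :=
  ℓ = pairedLossD ∨ ℓ = pairedLossE ∨ ℓ = pairedLossS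

theorem IsPairedLoss.continuous {ℓ : ℝ → ℝ → ℝ → ℝ} (h : IsPairedLoss ℓ) :
    Continuous fun t : ℝ × ℝ × ℝ => ℓ t.1 t.2.1 t.2.2 := by
  rcases h with rfl | rfl | rfl
  · unfold pairedLossD; fun_prop
  · unfold pairedLossE; fun_prop
  · unfold pairedLossS; fun_prop

theorem IsPairedLoss.nonneg {ℓ : ℝ → ℝ → ℝ → ℝ} (h : IsPairedLoss ℓ) {a b y : ℝ}
    (ha : a ∈ Set.Icc (-1 : ℝ) 1) (hb : b ∈ Set.Icc (-1 : ℝ) 1) (hy : y = 1 ∨ y = -1) :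
    0 ≤ ℓ a b y := by
  obtain ⟨ha1, ha2⟩ := ha
  obtain ⟨hb1, hb2⟩ := hb
  rcases h with rfl | rfl | rfl <;> rcases hy with rfl | rfl <;>
    simp only [pairedLossD, pairedLossE, pairedLossS] <;>
    nlinarith [mul_nonneg (sub_nonneg.mpr ha1) (sub_nonneg.mpr hb1),
      mul_nonneg (sub_nonneg.mpr ha2) (sub_nonneg.mpr hb2),
      mul_nonneg (sub_nonneg.mpr ha1) (sub_nonneg.mpr hb2),
      mul_nonneg (sub_nonneg.mpr ha2) (sub_nonneg.mpr hb1)]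

theorem pairedLossD_add_pairedLossE_add_pairedLossS (a b : ℝ) {y : ℝ} (hy : y = 1 ∨ y = -1) :
    pairedLossD a b y + pairedLossE a b y + pairedLossS a b y = 1 := by
  rcases hy with rfl | rfl <;> simp only [pairedLossD, pairedLossE, pairedLossS] <;> ring

theorem IsPairedLoss.add_le_one {ℓ ℓ' : ℝ → ℝ → ℝ → ℝ} (h : IsPairedLoss ℓ) (h' : IsPairedLoss ℓ')
    (hne : ℓ ≠ ℓ') {a b y : ℝ} (ha : a ∈ Set.Icc (-1 : ℝ) 1) (hb : b ∈ Set.Icc (-1 : ℝ) 1)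
    (hy : y = 1 ∨ y = -1) : ℓ a b y + ℓ' a b y ≤ 1 := by
  have hsum := pairedLossD_add_pairedLossE_add_pairedLossS a b hy
  have hD := IsPairedLoss.nonneg (Or.inl rfl) ha hb hy
  have hE := IsPairedLoss.nonneg (Or.inr (Or.inl rfl)) ha hb hy
  have hS := IsPairedLoss.nonneg (Or.inr (Or.inr rfl)) ha hb hy
  rcases h with rfl | rfl | rfl <;> rcases h' with rfl | rfl | rfl <;>
    first
    | exact absurd rfl hne
    | linarith

/-- The class of a label, with every label other than `1` sent to `-1`. -/
noncomputable def labelSign (y : ℝ) : ℝ := if y = 1 then 1 else -1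

theorem labelSign_eq_or (y : ℝ) : labelSign y = 1 ∨ labelSign y = -1 := by
  unfold labelSign
  split_ifs <;> simp

theorem labelSign_of_eq_or {y : ℝ} (hy : y = 1 ∨ y = -1) : labelSign y = y := by
  rcases hy with rfl | rfl <;> norm_num [labelSign]

theorem measurable_labelSign : Measurable labelSign :=
  Measurable.ite (measurableSet_singleton 1) measurable_const measurable_const

/-- The paired loss `ℓ` of a pair of voters at a labelled point. -/
noncomputable def voterPairLoss {X ι : Type*} (F : ι → X → ℝ) (ℓ : ℝ → ℝ → ℝ → ℝ)
    (j : ι × ι) (z : X × ℝ) : ℝ :=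
  ℓ (F j.1 z.1) (F j.2 z.1) (labelSign z.2)

theorem measurable_voterPairLoss {X ι : Type*} [MeasurableSpace X] [MeasurableSpace ι]
    {F : ι → X → ℝ} (hF : Measurable fun q : ι × X => F q.1 q.2) {ℓ : ℝ → ℝ → ℝ → ℝ}
    (hℓ : IsPairedLoss ℓ) : Measurable (Function.uncurry (voterPairLoss F ℓ)) := by
  refine hℓ.continuous.measurable.comp (Measurable.prodMk ?_ (Measurable.prodMk ?_ ?_))
  · exact hF.comp ((measurable_fst.comp measurable_fst).prodMk (measurable_fst.comp measurable_snd))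
  · exact hF.comp ((measurable_snd.comp measurable_fst).prodMk (measurable_fst.comp measurable_snd))
  · exact measurable_labelSign.comp (measurable_snd.comp measurable_snd)

/-- PAC-Bayesian theorem for any pair among `d_Q`, `e_Q`, `s_Q`: for two distinct
choices `α, β` among the expected disagreement, joint error and joint success, with
probability at least `1 - δ` over `S ∼ D^m`, simultaneously for all posteriors `Q`,
`kl(α_Q^S, β_Q^S ‖ α_Q^D, β_Q^D) ≤ (1/m)·[2·KL(Q‖P) + ln((ξ(m)+m)/δ)]`. -/
theorem statement13 {X ι : Type*} [MeasurableSpace X] [MeasurableSpace ι]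
    (D : Measure (X × ℝ)) [IsProbabilityMeasure D]
    (hY : ∀ᵐ p ∂D, p.2 = 1 ∨ p.2 = -1)
    (F : ι → X → ℝ) (hF : ∀ i x, F i x ∈ Set.Icc (-1 : ℝ) 1)
    (hFmeas : Measurable fun q : ι × X => F q.1 q.2)
    (P : Measure ι) [IsProbabilityMeasure P]
    (δ : ℝ) (hδ : δ ∈ Set.Ioc (0 : ℝ) 1)
    (m : ℕ) (hm : 0 < m)
    (ℓα ℓβ : ℝ → ℝ → ℝ → ℝ)
    (hα : ℓα = pairedLossD ∨ ℓα = pairedLossE ∨ ℓα = pairedLossS)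
    (hβ : ℓβ = pairedLossD ∨ ℓβ = pairedLossE ∨ ℓβ = pairedLossS)
    (hαβ : ℓα ≠ ℓβ) :
    ENNReal.ofReal (1 - δ) ≤
      (Measure.pi fun _ : Fin m => D)
        {S | ∀ Q : Measure ι, IsProbabilityMeasure Q →
          ((klTri
              ((m : ℝ)⁻¹ * ∑ k, ∫ i, ∫ j, ℓα (F i (S k).1) (F j (S k).1) (S k).2 ∂Q ∂Q)
              ((m : ℝ)⁻¹ * ∑ k, ∫ i, ∫ j, ℓβ (F i (S k).1) (F j (S k).1) (S k).2 ∂Q ∂Q)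
              (∫ p, ∫ i, ∫ j, ℓα (F i p.1) (F j p.1) p.2 ∂Q ∂Q ∂D)
              (∫ p, ∫ i, ∫ j, ℓβ (F i p.1) (F j p.1) p.2 ∂Q ∂Q ∂D) : ℝ) : EReal) ≤
            (((m : ℝ)⁻¹ : ℝ) : EReal) *
              (((2 : ℝ) : EReal) * klDivE Q P
                + ((Real.log ((xi m + m) / δ) : ℝ) : EReal))} := by
  have hm0 : (0 : ℝ) < m := by exact_mod_cast hm
  have hα' : IsPairedLoss ℓα := hα
  have hβ' : IsPairedLoss ℓβ := hβ
  have hα0 : ∀ j z, 0 ≤ voterPairLoss F ℓα j z := fun j z =>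
    hα'.nonneg (hF _ _) (hF _ _) (labelSign_eq_or _)
  have hβ0 : ∀ j z, 0 ≤ voterPairLoss F ℓβ j z := fun j z =>
    hβ'.nonneg (hF _ _) (hF _ _) (labelSign_eq_or _)
  have hle : ∀ j z, voterPairLoss F ℓα j z + voterPairLoss F ℓβ j z ≤ 1 := fun j z =>
    hα'.add_le_one hβ' hαβ (hF _ _) (hF _ _) (labelSign_eq_or _)
  set G : Fin 3 → ι × ι → X × ℝ → ℝ := ![voterPairLoss F ℓα, voterPairLoss F ℓβ,
    fun j z => 1 - voterPairLoss F ℓα j z - voterPairLoss F ℓβ j z] with hGdef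
  have hG0 : ∀ c j z, 0 ≤ G c j z := by
    intro c j z
    fin_cases c
    · exact hα0 j z
    · exact hβ0 j z
    · have := hle j z
      simp only [hGdef]
      show 0 ≤ 1 - voterPairLoss F ℓα j z - voterPairLoss F ℓβ j z
      linarith
  have hGsum : ∀ j z, ∑ c, G c j z = 1 := by
    intro j z
    rw [Fin.sum_univ_three]
    show voterPairLoss F ℓα j z + voterPairLoss F ℓβ j z +
      (1 - voterPairLoss F ℓα j z - voterPairLoss F ℓβ j z) = 1
    ring
  have hG1 : ∀ c j z, G c j z ≤ 1 := fun c j z => by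
    rw [← hGsum j z]
    exact Finset.single_le_sum (fun c _ => hG0 c j z) (Finset.mem_univ c)
  have hG : ∀ c, Measurable (Function.uncurry (G c)) := by
    intro c
    have h1 := measurable_voterPairLoss hFmeas hα'
    have h2 := measurable_voterPairLoss hFmeas hβ'
    fin_cases c
    · exact h1
    · exact h2
    · exact (measurable_const.sub h1).sub h2
  refine (ofReal_one_sub_le_measure_lintegral_multinomialMajorant_lt D (P.prod P) hm hδ.1 G hG hG0
    hG1).trans (measure_mono_ae ?_)
  have hYS : ∀ᵐ S ∂(Measure.pi fun _ : Fin m => D), ∀ k, (S k).2 = 1 ∨ (S k).2 = -1 := by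
    rw [ae_all_iff]
    intro k
    exact (measurePreserving_eval (fun _ : Fin m => D) k).quasiMeasurePreserving.ae hY
  filter_upwards [hYS] with S hYS hS Q hQ
  by_cases hKL : Q ≪ P ∧ Integrable (fun i => Real.log ((Q.rnDeriv P) i).toReal) Q
  swap
  · rw [klDivE, if_neg hKL, EReal.coe_mul_top_of_pos (by norm_num), EReal.top_add_coe,
      EReal.coe_mul_top_of_pos (by positivity)]
    exact le_top
  obtain ⟨hQP, hint⟩ := hKL
  have hB : 0 < (xi m + m) / δ := by
    by_contra hB
    have hS' : _ < _ := hS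
    rw [ENNReal.ofReal_of_nonpos (not_lt.mp hB)] at hS'
    exact not_lt_zero hS'
  have hmain := sum_mul_log_div_le_of_lintegral_multinomialMajorant_le D (hQP.prod hQP)
    (integrable_llr_prod_self hQP hint) hm hB G hG hG0 hGsum S (le_of_lt hS)
  rw [integral_llr_prod_self hQP hint] at hmain
  have hGz : ∀ c z, Integrable (fun j => G c j z) (Q.prod Q) := fun c z =>
    Integrable.of_bound ((hG c).comp measurable_prodMk_right).aestronglyMeasurable 1
      (Filter.Eventually.of_forall fun j => by
        rw [Real.norm_eq_abs, abs_of_nonneg (hG0 c j z)]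
        exact hG1 c j z)
  have hGu : ∀ c, Integrable (Function.uncurry (G c)) ((Q.prod Q).prod D) := fun c =>
    Integrable.of_bound (hG c).aestronglyMeasurable 1
      (Filter.Eventually.of_forall fun y => by
        rw [Real.norm_eq_abs, Function.uncurry_def, abs_of_nonneg (hG0 c _ _)]
        exact hG1 c _ _)
  set a : Fin 3 → ℝ := fun c => (m : ℝ)⁻¹ * ∑ k, ∫ j, G c j (S k) ∂(Q.prod Q) with ha
  set b : Fin 3 → ℝ := fun c => ∫ j, ∫ z, G c j z ∂D ∂(Q.prod Q) with hb
  have hswap : ∀ c, b c = ∫ z, ∫ j, G c j z ∂(Q.prod Q) ∂D := fun c =>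
    integral_integral_swap (hGu c)
  have hsumz : ∀ z, ∑ c, ∫ j, G c j z ∂(Q.prod Q) = 1 := by
    intro z
    rw [← integral_finsetSum _ fun c _ => hGz c z]
    simp [hGsum]
  have hsuma : ∑ c, a c = 1 := by
    simp only [ha]
    rw [← Finset.mul_sum, Finset.sum_comm, Finset.sum_congr rfl fun k _ => hsumz (S k)]
    simp [hm0.ne']
  have hsumb : ∑ c, b c = 1 := by
    rw [Finset.sum_congr rfl fun c _ => hswap c]
    refine (integral_finsetSum _ fun c _ => (hGu c).integral_prod_right).symm.trans ?_
    simp [hsumz]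
  have hinner : ∀ (c : Fin 3) (ℓ : ℝ → ℝ → ℝ → ℝ), G c = voterPairLoss F ℓ → ∀ z : X × ℝ,
      (z.2 = 1 ∨ z.2 = -1) →
      ∫ i, ∫ j, ℓ (F i z.1) (F j z.1) z.2 ∂Q ∂Q = ∫ j, G c j z ∂(Q.prod Q) := by
    intro c ℓ hc z hz
    rw [integral_prod _ (hGz c z), hc]
    simp only [voterPairLoss, labelSign_of_eq_or hz]
  have hemp : ∀ (c : Fin 3) (ℓ : ℝ → ℝ → ℝ → ℝ), G c = voterPairLoss F ℓ →
      (m : ℝ)⁻¹ * ∑ k, ∫ i, ∫ j, ℓ (F i (S k).1) (F j (S k).1) (S k).2 ∂Q ∂Q = a c := by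
    intro c ℓ hc
    simp only [ha]
    rw [Finset.sum_congr rfl fun k _ => hinner c ℓ hc (S k) (hYS k)]
  have hexp : ∀ (c : Fin 3) (ℓ : ℝ → ℝ → ℝ → ℝ), G c = voterPairLoss F ℓ →
      ∫ p, ∫ i, ∫ j, ℓ (F i p.1) (F j p.1) p.2 ∂Q ∂Q ∂D = b c := by
    intro c ℓ hc
    rw [hswap c]
    refine integral_congr_ae ?_
    filter_upwards [hY] with z hz
    exact hinner c ℓ hc z hz
  rw [hemp 0 ℓα rfl, hemp 1 ℓβ rfl, hexp 0 ℓα rfl, hexp 1 ℓβ rfl, klDivE, if_pos ⟨hQP, hint⟩]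
  rw [Fin.sum_univ_three] at hsuma hsumb hmain
  have hkl : klTri (a 0) (a 1) (b 0) (b 1) = a 0 * Real.log (a 0 / b 0) +
      a 1 * Real.log (a 1 / b 1) + a 2 * Real.log (a 2 / b 2) := by
    rw [klTri, show 1 - a 0 - a 1 = a 2 by linarith, show 1 - b 0 - b 1 = b 2 by linarith]
  rw [hkl]
  exact_mod_cast hmain
end

section
/- For any distribution D on X × {-1,1}, any pair of voters f_i, f_j : X → [-1,1], any two distinct paired losses L_α, L_β among {L_e, L_s, L_d}, and any positive integer m: E_{S∼D^m} exp(m·kl(E_{α,S}, E_{β,S} ‖ E_{α,D}, E_{β,D})) ≤ ξ(m) + m, where E_{α,D'} := E_{(x,y)∼D'} L_α(f_i(x), f_j(x), y) and E_{α,S} is the same average under the uniform (empirical) distribution on the sample S; consequently m + √m ≤ ξ(m) + m ≤ m + 2√m. -/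
open MeasureTheory

section Combinatorics

open Finset

lemma sum_neg_one_pow_mul_choose_mul_pow (n : ℕ) :
    ∑ k ∈ range (n + 1), (-1 : ℝ) ^ (n - k) * (n.choose k : ℝ) * (k : ℝ) ^ n = n.factorial := by
  have h := congrFun (fwdDiff_iter_eq_factorial (R := ℝ) (n := n)) 0
  rw [fwdDiff_iter_eq_sum_shift] at h
  simpa [zsmul_eq_mul] using h

/-- Cauchy's form of Abel's binomial identity. -/
lemma sum_choose_mul_pow_self_mul_sub_pow (n : ℕ) (y : ℝ) :
    ∑ k ∈ range (n + 1), (n.choose k : ℝ) * (k : ℝ) ^ k * (y - k) ^ (n - k) =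
      ∑ j ∈ range (n + 1), (n.descFactorial j : ℝ) * y ^ (n - j) := by
  induction n generalizing y with
  | zero => simp
  | succ n ih =>
    let F : ℝ → ℝ := fun y =>
      ∑ k ∈ range (n + 2), ((n + 1).choose k : ℝ) * (k : ℝ) ^ k * (y - k) ^ (n + 1 - k)
    let G : ℝ → ℝ := fun y =>
      ∑ j ∈ range (n + 2), ((n + 1).descFactorial j : ℝ) * y ^ (n + 1 - j)
    have hF (y : ℝ) : HasDerivAt F ((n + 1) *
        ∑ k ∈ range (n + 1), (n.choose k : ℝ) * (k : ℝ) ^ k * (y - k) ^ (n - k)) y := by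
      have h : HasDerivAt F (∑ k ∈ range (n + 2), ((n + 1).choose k : ℝ) * (k : ℝ) ^ k *
          ((n + 1 - k : ℕ) * (y - k) ^ (n + 1 - k - 1) * 1)) y :=
        HasDerivAt.fun_sum fun k _ =>
          (((hasDerivAt_id y).sub_const (k : ℝ)).pow (n + 1 - k)).const_mul _
      convert h using 1
      rw [sum_range_succ _ (n + 1), mul_sum]
      simp only [Nat.sub_self, Nat.cast_zero, zero_mul, mul_zero, add_zero]
      refine sum_congr rfl fun k hk => ?_
      have hk' : k ≤ n := Nat.lt_succ_iff.mp (mem_range.mp hk)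
      have hc : (n.choose k : ℝ) * (n + 1) = (n + 1).choose k * (n + 1 - k : ℕ) := by
        exact_mod_cast Nat.choose_mul_succ_eq n k
      rw [show n + 1 - k - 1 = n - k by omega]
      linear_combination (k : ℝ) ^ k * (y - k) ^ (n - k) * hc
    have hG (y : ℝ) : HasDerivAt G ((n + 1) *
        ∑ j ∈ range (n + 1), (n.descFactorial j : ℝ) * y ^ (n - j)) y := by
      have h : HasDerivAt G (∑ j ∈ range (n + 2), ((n + 1).descFactorial j : ℝ) *
          ((n + 1 - j : ℕ) * y ^ (n + 1 - j - 1) * 1)) y :=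
        HasDerivAt.fun_sum fun j _ => ((hasDerivAt_id y).pow (n + 1 - j)).const_mul _
      convert h using 1
      rw [sum_range_succ _ (n + 1), mul_sum]
      simp only [Nat.sub_self, Nat.cast_zero, zero_mul, mul_zero, add_zero]
      refine sum_congr rfl fun j hj => ?_
      have hc : ((n + 1 - j : ℕ) : ℝ) * (n + 1).descFactorial j =
          (n + 1) * n.descFactorial j := by
        exact_mod_cast (Nat.descFactorial_succ (n + 1) j).symm.trans
          (Nat.succ_descFactorial_succ n j)
      rw [show n + 1 - j - 1 = n - j by omega]
      linear_combination (-y ^ (n - j)) * hc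
    have hconst : F y - G y = F 0 - G 0 :=
      is_const_of_deriv_eq_zero (f := fun y => F y - G y)
        (fun y => ((hF y).sub (hG y)).differentiableAt)
        (fun y => by rw [((hF y).fun_sub (hG y)).deriv, ih, sub_self]) y 0
    have hF0 : F 0 = (n + 1).factorial := by
      rw [← sum_neg_one_pow_mul_choose_mul_pow]
      refine sum_congr rfl fun k hk => ?_
      have hk' : k + (n + 1 - k) = n + 1 := by have := mem_range.mp hk; omega
      have hp : (k : ℝ) ^ (n + 1) = (k : ℝ) ^ k * (k : ℝ) ^ (n + 1 - k) := by
        rw [← pow_add, hk']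
      rw [zero_sub, neg_pow, hp]
      ring
    have hG0 : G 0 = (n + 1).factorial := by
      simp only [G]
      rw [sum_range_succ, sum_eq_zero]
      · rw [Nat.descFactorial_self, Nat.sub_self, pow_zero, zero_add, mul_one]
      · intro j hj
        rw [zero_pow (by have := mem_range.mp hj; omega), mul_zero]
    change F y = G y
    linarith

/-- Ramanujan's expansion `ξ(m) = ∑ j, m(m-1)⋯(m-j+1) / m ^ j`. -/
lemma xi_eq_sum_descFactorial {m : ℕ} (hm : 0 < m) :
    xi m = ∑ j ∈ range (m + 1), (m.descFactorial j : ℝ) / (m : ℝ) ^ j := by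
  have hm' : (m : ℝ) ≠ 0 := by positivity
  have h := sum_choose_mul_pow_self_mul_sub_pow m (m : ℝ)
  apply mul_left_cancel₀ (pow_ne_zero m hm')
  rw [xi, mul_sum, mul_sum]
  convert h using 1
  · refine sum_congr rfl fun k hk => ?_
    have hk' : k + (m - k) = m := by have := mem_range.mp hk; omega
    have hp : (m : ℝ) ^ m = (m : ℝ) ^ k * (m : ℝ) ^ (m - k) := by rw [← pow_add, hk']
    rw [one_sub_div hm', div_pow, div_pow, hp]
    field_simp
  · refine sum_congr rfl fun k hk => ?_
    have hk' : k + (m - k) = m := by have := mem_range.mp hk; omega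
    have hp : (m : ℝ) ^ m = (m : ℝ) ^ k * (m : ℝ) ^ (m - k) := by rw [← pow_add, hk']
    rw [hp]
    field_simp

lemma choose_mul_descFactorial_sub (m j k : ℕ) :
    m.choose k * (m - k).descFactorial j = m.descFactorial j * (m - j).choose k := by
  apply Nat.eq_of_mul_eq_mul_left (Nat.factorial_pos k)
  have h1 := Nat.descFactorial_mul_descFactorial (n := m) (Nat.le_add_right k j)
  have h2 := Nat.descFactorial_mul_descFactorial (n := m) (Nat.le_add_right j k)
  rw [Nat.add_sub_cancel_left] at h1 h2
  calc _ = (m - k).descFactorial j * m.descFactorial k := by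
        rw [Nat.descFactorial_eq_factorial_mul_choose m k]; ring
    _ = (m - j).descFactorial k * m.descFactorial j := by rw [h1, h2, add_comm]
    _ = _ := by rw [Nat.descFactorial_eq_factorial_mul_choose (m - j) k]; ring

lemma descFactorial_succ_div_pow {m : ℕ} (hm : 0 < m) {n : ℕ} (hn : n ≤ m) :
    (m : ℝ) * ((m.descFactorial (n + 1) : ℝ) / (m : ℝ) ^ (n + 1)) =
      (m - n) * ((m.descFactorial n : ℝ) / (m : ℝ) ^ n) := by
  have hm' : (m : ℝ) ≠ 0 := by positivity
  rw [Nat.descFactorial_succ, Nat.cast_mul, Nat.cast_sub hn, pow_succ]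
  field_simp

lemma sum_mul_descFactorial_div_pow {m : ℕ} (hm : 0 < m) :
    ∑ j ∈ range (m + 1), (j : ℝ) * ((m.descFactorial j : ℝ) / (m : ℝ) ^ j) = m := by
  have key : ∀ n ≤ m + 1, ∑ j ∈ range n, (j : ℝ) * ((m.descFactorial j : ℝ) / (m : ℝ) ^ j) =
      m * (1 - (m.descFactorial n : ℝ) / (m : ℝ) ^ n) := by
    intro n
    induction n with
    | zero => simp
    | succ n ih =>
      intro hn
      rw [sum_range_succ, ih (by omega)]
      linear_combination descFactorial_succ_div_pow hm (Nat.lt_succ_iff.mp hn)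
  simp [key (m + 1) le_rfl]

lemma sum_sq_mul_descFactorial_div_pow {m : ℕ} (hm : 0 < m) :
    ∑ j ∈ range (m + 1), (j : ℝ) ^ 2 * ((m.descFactorial j : ℝ) / (m : ℝ) ^ j) =
      m * (xi m - 1) := by
  have key : ∀ n ≤ m + 1,
      ∑ j ∈ range n, (j : ℝ) ^ 2 * ((m.descFactorial j : ℝ) / (m : ℝ) ^ j) =
        m * (∑ j ∈ range n, (m.descFactorial j : ℝ) / (m : ℝ) ^ j - 1 -
          (n - 1) * ((m.descFactorial n : ℝ) / (m : ℝ) ^ n)) := by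
    intro n
    induction n with
    | zero => simp
    | succ n ih =>
      intro hn
      rw [sum_range_succ, ih (by omega), sum_range_succ]
      push_cast
      linear_combination n * descFactorial_succ_div_pow hm (Nat.lt_succ_iff.mp hn)
  simp [key (m + 1) le_rfl, xi_eq_sum_descFactorial hm]

lemma sum_sq_mul_succ_mul_descFactorial_div_pow {m : ℕ} (hm : 0 < m) :
    ∑ j ∈ range (m + 1), (j : ℝ) ^ 2 * (j + 1) * ((m.descFactorial j : ℝ) / (m : ℝ) ^ j) =
      2 * (m : ℝ) ^ 2 := by
  have key : ∀ n ≤ m + 1,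
      ∑ j ∈ range n, (j : ℝ) ^ 2 * (j + 1) * ((m.descFactorial j : ℝ) / (m : ℝ) ^ j) =
        m * (2 * ∑ j ∈ range n, (j : ℝ) * ((m.descFactorial j : ℝ) / (m : ℝ) ^ j) -
          n * (n - 1) * ((m.descFactorial n : ℝ) / (m : ℝ) ^ n)) := by
    intro n
    induction n with
    | zero => simp
    | succ n ih =>
      intro hn
      rw [sum_range_succ, ih (by omega), sum_range_succ]
      push_cast
      linear_combination n * (n + 1) * descFactorial_succ_div_pow hm (Nat.lt_succ_iff.mp hn)
  rw [key (m + 1) le_rfl, sum_mul_descFactorial_div_pow hm]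
  simp
  ring

lemma one_le_xi {m : ℕ} (hm : 0 < m) : 1 ≤ xi m := by
  rw [xi_eq_sum_descFactorial hm]
  refine le_trans (by simp) (single_le_sum (f := fun j => (m.descFactorial j : ℝ) / (m : ℝ) ^ j)
    (fun j _ => by positivity) (mem_range.mpr m.succ_pos))

lemma sqrt_le_xi {m : ℕ} (hm : 0 < m) : √(m : ℝ) ≤ xi m := by
  have hm' : (0 : ℝ) < m := by positivity
  have h1 := one_le_xi hm
  have hcs := sum_sq_le_sum_mul_sum_of_sq_le_mul (range (m + 1))
    (r := fun j => (j : ℝ) * ((m.descFactorial j : ℝ) / (m : ℝ) ^ j))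
    (f := fun j => (m.descFactorial j : ℝ) / (m : ℝ) ^ j)
    (g := fun j => (j : ℝ) ^ 2 * ((m.descFactorial j : ℝ) / (m : ℝ) ^ j))
    (fun j _ => by positivity) (fun j _ => by positivity) (fun j _ => le_of_eq (by ring))
  rw [sum_mul_descFactorial_div_pow hm, ← xi_eq_sum_descFactorial hm,
    sum_sq_mul_descFactorial_div_pow hm] at hcs
  have h2 : (m : ℝ) ≤ xi m * (xi m - 1) := by
    refine le_of_mul_le_mul_left ?_ hm'
    linarith
  exact Real.sqrt_le_iff.mpr ⟨by linarith, by nlinarith⟩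

lemma xi_le_two_mul_sqrt {m : ℕ} (hm : 0 < m) : xi m ≤ 2 * √(m : ℝ) := by
  have hm' : (1 : ℝ) ≤ m := by exact_mod_cast hm
  have hcs := sum_sq_le_sum_mul_sum_of_sq_le_mul (range (m + 1))
    (r := fun j => (j : ℝ) ^ 2 * ((m.descFactorial j : ℝ) / (m : ℝ) ^ j) +
      1 / 2 * ((j : ℝ) * ((m.descFactorial j : ℝ) / (m : ℝ) ^ j)))
    (f := fun j => (j : ℝ) * ((m.descFactorial j : ℝ) / (m : ℝ) ^ j))
    (g := fun j => (j : ℝ) ^ 2 * (j + 1) * ((m.descFactorial j : ℝ) / (m : ℝ) ^ j) +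
      1 / 4 * ((j : ℝ) * ((m.descFactorial j : ℝ) / (m : ℝ) ^ j)))
    (fun j _ => by positivity) (fun j _ => by positivity) (fun j _ => le_of_eq (by ring))
  simp only [sum_add_distrib, ← mul_sum] at hcs
  rw [sum_mul_descFactorial_div_pow hm, sum_sq_mul_descFactorial_div_pow hm,
    sum_sq_mul_succ_mul_descFactorial_div_pow hm] at hcs
  have h2 : (xi m - 1 / 2) ^ 2 ≤ 2 * m + 1 / 4 := by
    refine le_of_mul_le_mul_left ?_ (by positivity : (0 : ℝ) < (m : ℝ) ^ 2)
    linarith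
  have h3 : 1 ≤ √(m : ℝ) := Real.one_le_sqrt.mpr hm'
  have h4 : √(m : ℝ) ^ 2 = m := Real.sq_sqrt (by linarith)
  have h5 : xi m - 1 / 2 ≤ 2 * √(m : ℝ) - 1 / 2 :=
    le_of_sq_le_sq (by nlinarith) (by linarith)
  linarith

/-- The trinomial analogue of `xi`. -/
lemma sum_trinomial_eq_xi_add {m : ℕ} (hm : 0 < m) :
    ∑ k ∈ range (m + 1), (m.choose k : ℝ) * ∑ l ∈ range (m - k + 1), ((m - k).choose l : ℝ) *
      (((k : ℝ) / m) ^ k * ((l : ℝ) / m) ^ l *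
        (((m - k - l : ℕ) : ℝ) / m) ^ (m - k - l)) = xi m + m := by
  have hm' : (m : ℝ) ≠ 0 := by positivity
  apply mul_left_cancel₀ (pow_ne_zero m hm')
  calc _ = ∑ k ∈ range (m + 1), (m.choose k : ℝ) * (k : ℝ) ^ k *
        ∑ l ∈ range (m - k + 1), ((m - k).choose l : ℝ) * (l : ℝ) ^ l *
          (((m - k : ℕ) : ℝ) - l) ^ (m - k - l) := by
        rw [mul_sum]
        refine sum_congr rfl fun k hk => ?_
        rw [mul_sum, mul_sum, mul_sum]
        refine sum_congr rfl fun l hl => ?_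
        have hkl : k + l + (m - k - l) = m := by
          have := mem_range.mp hk; have := mem_range.mp hl; omega
        have hp : (m : ℝ) ^ m = (m : ℝ) ^ k * (m : ℝ) ^ l * (m : ℝ) ^ (m - k - l) := by
          rw [← pow_add, ← pow_add, hkl]
        rw [Nat.cast_sub (by omega : l ≤ m - k), div_pow, div_pow, div_pow, hp]
        field_simp
    _ = ∑ k ∈ range (m + 1), ∑ j ∈ range (m - k + 1), (m.descFactorial j : ℝ) *
          ((m - j).choose k * (k : ℝ) ^ k * ((m : ℝ) - k) ^ (m - j - k)) := by
        refine sum_congr rfl fun k hk => ?_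
        rw [sum_choose_mul_pow_self_mul_sub_pow, mul_sum]
        refine sum_congr rfl fun j hj => ?_
        have h : (m.choose k : ℝ) * (m - k).descFactorial j =
            m.descFactorial j * (m - j).choose k := by
          exact_mod_cast choose_mul_descFactorial_sub m j k
        rw [Nat.cast_sub (Nat.lt_succ_iff.mp (mem_range.mp hk)), Nat.sub_right_comm]
        linear_combination (k : ℝ) ^ k * ((m : ℝ) - k) ^ (m - j - k) * h
    _ = ∑ j ∈ range (m + 1), ∑ k ∈ range (m - j + 1), (m.descFactorial j : ℝ) *
          ((m - j).choose k * (k : ℝ) ^ k * ((m : ℝ) - k) ^ (m - j - k)) := by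
        apply sum_comm'
        intro k j
        simp only [mem_range]
        omega
    _ = ∑ j ∈ range (m + 1), ∑ i ∈ range (m + 1 - j),
          (m.descFactorial (j + i) : ℝ) * (m : ℝ) ^ (m - (j + i)) := by
        refine sum_congr rfl fun j hj => ?_
        rw [← mul_sum, sum_choose_mul_pow_self_mul_sub_pow, mul_sum,
          Nat.sub_add_comm (Nat.lt_succ_iff.mp (mem_range.mp hj))]
        refine sum_congr rfl fun i hi => ?_
        have h := Nat.descFactorial_mul_descFactorial (n := m) (Nat.le_add_right j i)
        rw [Nat.add_sub_cancel_left] at h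
        rw [← h, Nat.sub_sub]
        push_cast
        ring
    _ = ∑ s ∈ range (m + 1), ((s : ℝ) + 1) *
          ((m.descFactorial s : ℝ) * (m : ℝ) ^ (m - s)) := by
        rw [← sum_range_diag_flip (m + 1) fun j i =>
          (m.descFactorial (j + i) : ℝ) * (m : ℝ) ^ (m - (j + i))]
        refine sum_congr rfl fun s _ => ?_
        rw [sum_congr rfl fun k hk => by
          rw [Nat.add_sub_cancel' (Nat.lt_succ_iff.mp (mem_range.mp hk))]]
        simp
    _ = (m : ℝ) ^ m * ∑ s ∈ range (m + 1), ((s : ℝ) + 1) *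
          ((m.descFactorial s : ℝ) / (m : ℝ) ^ s) := by
        rw [mul_sum]
        refine sum_congr rfl fun s hs => ?_
        have hs' : s + (m - s) = m := by have := mem_range.mp hs; omega
        have hp : (m : ℝ) ^ m = (m : ℝ) ^ s * (m : ℝ) ^ (m - s) := by rw [← pow_add, hs']
        rw [hp]
        field_simp
    _ = _ := by
        simp only [add_mul, one_mul, sum_add_distrib]
        rw [sum_mul_descFactorial_div_pow hm, ← xi_eq_sum_descFactorial hm]
        simp [add_comm]

lemma sum_fin_three_colorings (m : ℕ) (G : ℕ → ℕ → ℕ → ℝ) :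
    ∑ η : Fin m → Fin 3, G #{i | η i = 0} #{i | η i = 1} #{i | η i = 2} =
      ∑ k ∈ range (m + 1), (m.choose k : ℝ) *
        ∑ l ∈ range (m - k + 1), ((m - k).choose l : ℝ) * G k l (m - k - l) := by
  have inner (A : Finset (Fin m)) : ∑ B ∈ Aᶜ.powerset, G #A #B (m - #A - #B) =
      ∑ l ∈ range (m - #A + 1), ((m - #A).choose l : ℝ) * G #A l (m - #A - l) := by
    rw [sum_powerset_apply_card (fun l => G #A l (m - #A - l)), card_compl, Fintype.card_fin]
    simp only [nsmul_eq_mul]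
  have outer := sum_powerset_apply_card (x := (univ : Finset (Fin m))) (fun k =>
    ∑ l ∈ range (m - k + 1), ((m - k).choose l : ℝ) * G k l (m - k - l))
  simp only [nsmul_eq_mul, card_univ, Fintype.card_fin, ← inner] at outer
  rw [← outer, sum_sigma']
  refine sum_bij' (fun η _ => ⟨({i | η i = 0} : Finset (Fin m)), ({i | η i = 1} : Finset (Fin m))⟩)
    (fun AB _ i => if i ∈ AB.1 then 0 else if i ∈ AB.2 then 1 else 2) ?_ ?_ ?_ ?_ ?_
  · intro η _
    simp only [mem_sigma, mem_powerset, subset_univ, true_and]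
    intro i hi
    simp only [mem_filter, mem_univ, true_and, mem_compl] at hi ⊢
    simp [hi]
  · simp
  · intro η _
    funext i
    have : ∀ c : Fin 3, (if c = 0 then 0 else if c = 1 then 1 else 2) = c := by decide
    simpa using this (η i)
  · rintro ⟨A, B⟩ h
    simp only [mem_sigma, mem_powerset, subset_univ, true_and] at h
    have h' : ∀ i, i ∈ B → i ∉ A := fun i hi => mem_compl.mp (h hi)
    have hA : ({i | (if i ∈ A then (0 : Fin 3) else if i ∈ B then 1 else 2) = 0} :
        Finset (Fin m)) = A := by
      ext i
      by_cases h1 : i ∈ A <;> by_cases h2 : i ∈ B <;> simp [h1, h2]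
    have hB : ({i | (if i ∈ A then (0 : Fin 3) else if i ∈ B then 1 else 2) = 1} :
        Finset (Fin m)) = B := by
      ext i
      by_cases h1 : i ∈ A <;> by_cases h2 : i ∈ B <;> simp [h1, h2]
      exact h' i h2 h1
    simp only [hA, hB]
  · intro η _
    have h := card_eq_sum_card_fiberwise (s := univ) (t := univ) (f := η) (fun _ _ => by simp)
    rw [card_univ, Fintype.card_fin, Fin.sum_univ_three] at h
    congr 1
    dsimp only
    omega

lemma convexOn_mul_log_div {p : ℝ} (hp : 0 ≤ p) :
    ConvexOn ℝ (Set.Ici 0) fun q : ℝ => q * Real.log (q / p) := by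
  rcases hp.eq_or_lt with rfl | hp
  · simpa using convexOn_const (0 : ℝ) (convex_Ici (0 : ℝ))
  · refine (Real.convexOn_mul_log.sub
      ((LinearMap.mulRight ℝ (Real.log p)).concaveOn (convex_Ici 0))).congr fun q hq => ?_
    rcases (Set.mem_Ici.mp hq).eq_or_lt with rfl | hq
    · simp
    · simp [Real.log_div hq.ne' hp.ne', mul_sub]

/-- Jensen's inequality for `exp (m * kl)`: the extreme points of the simplex maximise its mean. -/
lemma exp_mul_sum_mul_log_le {m : ℕ} {ι : Type*} [Fintype ι] [DecidableEq ι]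
    (x : Fin m → ι → ℝ) (hx0 : ∀ k c, 0 ≤ x k c) (hx1 : ∀ k, ∑ c, x k c = 1)
    (p : ι → ℝ) (hp : ∀ c, 0 ≤ p c) :
    Real.exp (m * ∑ c, ((m : ℝ)⁻¹ * ∑ k, x k c) *
        Real.log (((m : ℝ)⁻¹ * ∑ k, x k c) / p c)) ≤
      ∑ η : Fin m → ι, (∏ k, x k (η k)) * Real.exp (m * ∑ c, ((m : ℝ)⁻¹ * #{i | η i = c}) *
        Real.log (((m : ℝ)⁻¹ * #{i | η i = c}) / p c)) := by
  have hw0 : ∀ η ∈ (univ : Finset (Fin m → ι)), 0 ≤ ∏ k, x k (η k) :=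
    fun η _ => prod_nonneg fun k _ => hx0 k _
  have hw1 : ∑ η : Fin m → ι, ∏ k, x k (η k) = 1 := by
    rw [← Fintype.piFinset_univ, ← prod_univ_sum]
    simp [hx1]
  have hmean (c : ι) : ∑ η : Fin m → ι, (∏ k, x k (η k)) * ((m : ℝ)⁻¹ * #{i | η i = c}) =
      (m : ℝ)⁻¹ * ∑ k, x k c := by
    have hi (i : Fin m) :
        ∑ η : Fin m → ι, (∏ k, x k (η k)) * (if η i = c then 1 else 0) = x i c := by
      have hprod (η : Fin m → ι) : (∏ k, x k (η k)) * (if η i = c then 1 else 0) =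
          ∏ k, x k (η k) * (if k = i then (if η k = c then 1 else 0) else 1) := by
        rw [prod_mul_distrib, prod_ite_eq' univ i]
        simp
      simp only [hprod]
      rw [← Fintype.piFinset_univ, ← prod_univ_sum (fun _ => univ)
        (fun k d => x k d * (if k = i then (if d = c then 1 else 0) else 1)),
        prod_eq_single i]
      · simp
      · intro k _ hk
        simp [hk, hx1]
      · simp
    calc _ = ∑ η : Fin m → ι, ∑ i, (m : ℝ)⁻¹ *
          ((∏ k, x k (η k)) * (if η i = c then 1 else 0)) := by
          refine sum_congr rfl fun η _ => ?_
          rw [← mul_sum, ← mul_sum, sum_boole]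
          ring
      _ = _ := by
          rw [sum_comm, mul_sum]
          simp only [← mul_sum, hi]
  have hphi (c : ι) := (convexOn_mul_log_div (hp c)).map_sum_le (t := univ)
    (w := fun η : Fin m → ι => ∏ k, x k (η k)) (p := fun η => (m : ℝ)⁻¹ * #{i | η i = c})
    hw0 hw1 (fun η _ => Set.mem_Ici.mpr (by positivity))
  simp only [smul_eq_mul, hmean] at hphi
  have hexp := convexOn_exp.map_sum_le (t := univ)
    (w := fun η : Fin m → ι => ∏ k, x k (η k))
    (p := fun η => m * ∑ c, ((m : ℝ)⁻¹ * #{i | η i = c}) *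
        Real.log (((m : ℝ)⁻¹ * #{i | η i = c}) / p c)) hw0 hw1 (fun η _ => Set.mem_univ _)
  simp only [smul_eq_mul] at hexp
  refine le_trans (Real.exp_le_exp.mpr ?_) hexp
  calc _ ≤ (m : ℝ) * ∑ c, ∑ η : Fin m → ι, (∏ k, x k (η k)) * (((m : ℝ)⁻¹ * #{i | η i = c}) *
        Real.log (((m : ℝ)⁻¹ * #{i | η i = c}) / p c)) := by
        gcongr with c
        exact hphi c
    _ = _ := by
        rw [sum_comm, mul_sum]
        refine sum_congr rfl fun η _ => ?_
        rw [← mul_sum]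
        ring

lemma prod_mul_exp_sum_mul_log_le {m : ℕ} (hm : 0 < m) {ι : Type*} [Fintype ι] [DecidableEq ι]
    (p : ι → ℝ) (hp : ∀ c, 0 ≤ p c) (η : Fin m → ι) :
    (∏ k, p (η k)) * Real.exp (m * ∑ c, ((m : ℝ)⁻¹ * #{i | η i = c}) *
        Real.log (((m : ℝ)⁻¹ * #{i | η i = c}) / p c)) ≤
      ∏ c, ((#{i | η i = c} : ℝ) / m) ^ #{i | η i = c} := by
  have hm' : (0 : ℝ) < m := by positivity
  have h1 : ∏ k, p (η k) = ∏ c, p c ^ #{i | η i = c} := by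
    rw [← prod_fiberwise univ η]
    refine prod_congr rfl fun c _ => ?_
    rw [prod_congr rfl fun k hk => by rw [(mem_filter.mp hk).2], prod_const]
  rw [h1, mul_sum, Real.exp_sum, ← prod_mul_distrib]
  refine prod_le_prod (fun c _ => mul_nonneg (pow_nonneg (hp c) _) (Real.exp_nonneg _))
    fun c _ => ?_
  generalize #{i | η i = c} = n
  rcases Nat.eq_zero_or_pos n with rfl | hn
  · simp
  rcases (hp c).eq_or_lt with h0 | h0
  · rw [← h0, zero_pow hn.ne', zero_mul]
    positivity
  · rw [← mul_assoc, mul_inv_cancel_left₀ hm'.ne', Real.exp_nat_mul,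
      Real.exp_log (by positivity), ← mul_pow]
    apply le_of_eq
    congr 1
    field_simp

/-- Maurer's lemma for trivalent variables. -/
lemma integral_exp_mul_sum_mul_log_le {Ω : Type*} [MeasurableSpace Ω] (D : Measure Ω)
    [IsProbabilityMeasure D] (g : Ω → Fin 3 → ℝ) (hgi : ∀ c, Integrable (fun z => g z c) D)
    (hg0 : ∀ᵐ z ∂D, ∀ c, 0 ≤ g z c) (hg1 : ∀ᵐ z ∂D, ∑ c, g z c = 1) {m : ℕ} (hm : 0 < m) :
    ∫ S, Real.exp (m * ∑ c, ((m : ℝ)⁻¹ * ∑ k, g (S k) c) *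
        Real.log (((m : ℝ)⁻¹ * ∑ k, g (S k) c) / ∫ z, g z c ∂D))
      ∂(Measure.pi fun _ : Fin m => D) ≤ xi m + m := by
  let p : Fin 3 → ℝ := fun c => ∫ z, g z c ∂D
  have hp (c : Fin 3) : 0 ≤ p c := integral_nonneg_of_ae (hg0.mono fun z hz => hz c)
  let E : (Fin m → Fin 3) → ℝ := fun η =>
    Real.exp (m * ∑ c, ((m : ℝ)⁻¹ * #{i | η i = c}) *
      Real.log (((m : ℝ)⁻¹ * #{i | η i = c}) / p c))
  have hae : ∀ᵐ S ∂(Measure.pi fun _ : Fin m => D),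
      ∀ k, (∀ c, 0 ≤ g (S k) c) ∧ ∑ c, g (S k) c = 1 := by
    rw [ae_all_iff]
    intro k
    exact (Measure.quasiMeasurePreserving_eval (fun _ : Fin m => D) k).ae (hg0.and hg1)
  have hint (η : Fin m → Fin 3) : Integrable (fun S : Fin m → Ω => (∏ k, g (S k) (η k)) * E η)
      (Measure.pi fun _ : Fin m => D) :=
    (Integrable.fintype_prod (f := fun k z => g z (η k)) fun k => hgi (η k)).mul_const _
  calc _ ≤ ∫ S, ∑ η : Fin m → Fin 3, (∏ k, g (S k) (η k)) * E η
        ∂(Measure.pi fun _ : Fin m => D) := by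
        refine integral_mono_of_nonneg (ae_of_all _ fun S => Real.exp_nonneg _)
          (integrable_finsetSum _ fun η _ => hint η) ?_
        filter_upwards [hae] with S hS
        exact exp_mul_sum_mul_log_le (fun k => g (S k)) (fun k => (hS k).1)
          (fun k => (hS k).2) p hp
    _ = ∑ η : Fin m → Fin 3, (∏ k, p (η k)) * E η := by
        rw [integral_finsetSum _ fun η _ => hint η]
        refine sum_congr rfl fun η _ => ?_
        rw [integral_mul_const, integral_fintype_prod_eq_prod (fun k z => g z (η k))]
    _ ≤ ∑ η : Fin m → Fin 3, ∏ c, ((#{i | η i = c} : ℝ) / m) ^ #{i | η i = c} :=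
        sum_le_sum fun η _ => prod_mul_exp_sum_mul_log_le hm p hp η
    _ = xi m + m := by
        simp only [Fin.prod_univ_three]
        rw [sum_fin_three_colorings m fun a b c => ((a : ℝ) / m) ^ a * ((b : ℝ) / m) ^ b *
          ((c : ℝ) / m) ^ c]
        exact sum_trinomial_eq_xi_add hm

end Combinatorics

lemma measurable_pairedLoss {ℓ : ℝ → ℝ → ℝ → ℝ}
    (hℓ : ℓ = pairedLossD ∨ ℓ = pairedLossE ∨ ℓ = pairedLossS) :
    Measurable fun q : ℝ × ℝ × ℝ => ℓ q.1 q.2.1 q.2.2 := by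
  rcases hℓ with rfl | rfl | rfl <;>
    simp only [pairedLossD, pairedLossE, pairedLossS] <;> fun_prop

lemma pairedLoss_nonneg {ℓ : ℝ → ℝ → ℝ → ℝ}
    (hℓ : ℓ = pairedLossD ∨ ℓ = pairedLossE ∨ ℓ = pairedLossS) {a b y : ℝ}
    (ha : a ∈ Set.Icc (-1 : ℝ) 1) (hb : b ∈ Set.Icc (-1 : ℝ) 1) (hy : y = 1 ∨ y = -1) :
    0 ≤ ℓ a b y := by
  obtain ⟨ha1, ha2⟩ := ha
  obtain ⟨hb1, hb2⟩ := hb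
  rcases hℓ with rfl | rfl | rfl <;> rcases hy with rfl | rfl <;>
    simp only [pairedLossD, pairedLossE, pairedLossS] <;> nlinarith

lemma pairedLossD_add_E_add_S {a b y : ℝ} (hy : y = 1 ∨ y = -1) :
    pairedLossD a b y + pairedLossE a b y + pairedLossS a b y = 1 := by
  rcases hy with rfl | rfl <;> simp only [pairedLossD, pairedLossE, pairedLossS] <;> ring

lemma pairedLoss_add_le_one {ℓα ℓβ : ℝ → ℝ → ℝ → ℝ}
    (hα : ℓα = pairedLossD ∨ ℓα = pairedLossE ∨ ℓα = pairedLossS)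
    (hβ : ℓβ = pairedLossD ∨ ℓβ = pairedLossE ∨ ℓβ = pairedLossS)
    (hαβ : ℓα ≠ ℓβ) {a b y : ℝ}
    (ha : a ∈ Set.Icc (-1 : ℝ) 1) (hb : b ∈ Set.Icc (-1 : ℝ) 1) (hy : y = 1 ∨ y = -1) :
    ℓα a b y + ℓβ a b y ≤ 1 := by
  have hsum := pairedLossD_add_E_add_S (a := a) (b := b) hy
  have hD := pairedLoss_nonneg (.inl rfl) ha hb hy
  have hE := pairedLoss_nonneg (.inr (.inl rfl)) ha hb hy
  have hS := pairedLoss_nonneg (.inr (.inr rfl)) ha hb hy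
  rcases hα with rfl | rfl | rfl <;> rcases hβ with rfl | rfl | rfl <;>
    first | exact absurd rfl hαβ | linarith

/-- For any pair of voters `fᵢ, fⱼ` and any two distinct paired losses `L_α, L_β` among
`{L_e, L_s, L_d}`:
`E_{S∼D^m} exp(m · kl(E_{α,S}, E_{β,S} ‖ E_{α,D}, E_{β,D})) ≤ ξ(m) + m`;
consequently `m + √m ≤ ξ(m) + m ≤ m + 2√m`. -/
theorem statement14 {X : Type*} [MeasurableSpace X]
    (D : Measure (X × ℝ)) [IsProbabilityMeasure D]
    (hY : ∀ᵐ p ∂D, p.2 = 1 ∨ p.2 = -1)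
    (fi fj : X → ℝ)
    (hfi : ∀ x, fi x ∈ Set.Icc (-1 : ℝ) 1) (hfj : ∀ x, fj x ∈ Set.Icc (-1 : ℝ) 1)
    (hfim : Measurable fi) (hfjm : Measurable fj)
    (ℓα ℓβ : ℝ → ℝ → ℝ → ℝ)
    (hα : ℓα = pairedLossD ∨ ℓα = pairedLossE ∨ ℓα = pairedLossS)
    (hβ : ℓβ = pairedLossD ∨ ℓβ = pairedLossE ∨ ℓβ = pairedLossS)
    (hαβ : ℓα ≠ ℓβ)
    (m : ℕ) (hm : 0 < m) :
    (∫ S, Real.exp ((m : ℝ) * klTri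
        ((m : ℝ)⁻¹ * ∑ k, ℓα (fi (S k).1) (fj (S k).1) (S k).2)
        ((m : ℝ)⁻¹ * ∑ k, ℓβ (fi (S k).1) (fj (S k).1) (S k).2)
        (∫ p, ℓα (fi p.1) (fj p.1) p.2 ∂D)
        (∫ p, ℓβ (fi p.1) (fj p.1) p.2 ∂D))
      ∂(Measure.pi fun _ : Fin m => D)) ≤ xi m + m ∧
    (m : ℝ) + Real.sqrt (m : ℝ) ≤ xi m + m ∧
    xi m + m ≤ (m : ℝ) + 2 * Real.sqrt (m : ℝ) := by
  have hsqrt := sqrt_le_xi hm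
  have hsqrt' := xi_le_two_mul_sqrt hm
  refine ⟨?_, by linarith, by linarith⟩
  let A : X × ℝ → ℝ := fun z => ℓα (fi z.1) (fj z.1) z.2
  let B : X × ℝ → ℝ := fun z => ℓβ (fi z.1) (fj z.1) z.2
  have hpair : Measurable fun z : X × ℝ => (fi z.1, fj z.1, z.2) := by fun_prop
  have hAB : ∀ᵐ z ∂D, 0 ≤ A z ∧ 0 ≤ B z ∧ A z + B z ≤ 1 := hY.mono fun z hz =>
    ⟨pairedLoss_nonneg hα (hfi _) (hfj _) hz, pairedLoss_nonneg hβ (hfi _) (hfj _) hz,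
      pairedLoss_add_le_one hα hβ hαβ (hfi _) (hfj _) hz⟩
  have hAi : Integrable A D :=
    Integrable.of_mem_Icc 0 1 ((measurable_pairedLoss hα).comp hpair).aemeasurable
      (hAB.mono fun z hz => ⟨hz.1, by linarith⟩)
  have hBi : Integrable B D :=
    Integrable.of_mem_Icc 0 1 ((measurable_pairedLoss hβ).comp hpair).aemeasurable
      (hAB.mono fun z hz => ⟨hz.2.1, by linarith⟩)
  have hAi' : Integrable (fun z => 1 - A z) D := (integrable_const 1).sub hAi
  have hCi : Integrable (fun z => 1 - A z - B z) D := hAi'.sub hBi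
  have hC : ∫ z, (1 - A z - B z) ∂D = 1 - ∫ z, A z ∂D - ∫ z, B z ∂D := by
    rw [integral_sub hAi' hBi, integral_sub (integrable_const 1) hAi]
    simp
  have hCS (S : Fin m → X × ℝ) : (m : ℝ)⁻¹ * ∑ k, (1 - A (S k) - B (S k)) =
      1 - (m : ℝ)⁻¹ * ∑ k, A (S k) - (m : ℝ)⁻¹ * ∑ k, B (S k) := by
    rw [Finset.sum_sub_distrib, Finset.sum_sub_distrib]
    simp only [Finset.sum_const, Finset.card_univ, Fintype.card_fin, nsmul_eq_mul, mul_one]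
    field_simp
  have h := integral_exp_mul_sum_mul_log_le D (fun z => ![A z, B z, 1 - A z - B z])
    (by
      intro c
      fin_cases c
      · exact hAi
      · exact hBi
      · exact hCi)
    (hAB.mono fun z hz c => by
      fin_cases c
      · exact hz.1
      · exact hz.2.1
      · change 0 ≤ 1 - A z - B z
        linarith [hz.2.2])
    (ae_of_all _ fun z => by simp [Fin.sum_univ_three]) hm
  simp only [Fin.sum_univ_three, Matrix.cons_val, hC, hCS] at h
  exact h
end

section
/- (Change of measure inequality for aligned posteriors.) Let H be a self-complemented set of voters with complement bijection c, P a prior probability distribution on H, and Q a posterior distribution aligned on P. For any measurable function φ : H → ℝ satisfying φ(c(f)) = φ(f) for all f ∈ H (and such that the expectations below exist), E_{f∼Q} φ(f) ≤ ln(E_{f∼P} e^{φ(f)}). -/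
open MeasureTheory

/-- If `Q + c_*Q = P + c_*P` and `φ ∘ c = φ`, then `φ` has the same law under `Q` as under
`P`. -/
theorem map_eq_map_of_add_map_eq {ι β : Type*} [MeasurableSpace ι] [MeasurableSpace β]
    {c : ι → ι} (hc : Measurable c) {P Q : Measure ι}
    (h : Q + Measure.map c Q = P + Measure.map c P)
    {φ : ι → β} (hφ : Measurable φ) (hφc : ∀ i, φ (c i) = φ i) :
    Measure.map φ Q = Measure.map φ P := by
  ext s hs
  rw [Measure.map_apply hφ hs, Measure.map_apply hφ hs]
  have hinv : c ⁻¹' (φ ⁻¹' s) = φ ⁻¹' s := by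
    ext i
    simp [hφc]
  have hadd := congrArg (fun μ : Measure ι => μ (φ ⁻¹' s)) h
  simp only [Measure.add_apply, Measure.map_apply hc (hφ hs), hinv, ← two_mul] at hadd
  exact (ENNReal.mul_right_inj two_ne_zero ENNReal.ofNat_ne_top).1 hadd

/-- Jensen's inequality for the exponential, in logarithmic form. -/
theorem integral_le_log_integral_exp {ι : Type*} [MeasurableSpace ι] {P : Measure ι}
    [IsProbabilityMeasure P] {φ : ι → ℝ} (hφ : Integrable φ P)
    (hexp : Integrable (fun i => Real.exp (φ i)) P) :
    (∫ i, φ i ∂P) ≤ Real.log (∫ i, Real.exp (φ i) ∂P) := by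
  rw [Real.le_log_iff_exp_le (integral_exp_pos hexp)]
  exact convexOn_exp.map_integral_le Real.continuous_exp.continuousOn isClosed_univ
    (by simp) hφ hexp

/-- Change of measure inequality for aligned posteriors: let the set of voters
(indexed by `ι`, via `F`) be self-complemented with complement bijection `c`
(`F (c i) = -(F i)`), let `P` be a prior and `Q` a posterior aligned on `P`
(`Q + c_*Q = P + c_*P`).  For any measurable `φ` with `φ ∘ c = φ` (whose relevant
expectations exist), `E_{f∼Q} φ(f) ≤ ln(E_{f∼P} e^{φ(f)})`. -/
theorem statement15 {X ι : Type*} [MeasurableSpace ι]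
    (F : ι → X → ℝ) (hF : ∀ i x, F i x ∈ Set.Icc (-1 : ℝ) 1)
    (c : ι → ι) (hc_bij : Function.Bijective c) (hc_meas : Measurable c)
    (hc : ∀ i x, F (c i) x = -(F i x))
    (P Q : Measure ι) [IsProbabilityMeasure P] [IsProbabilityMeasure Q]
    (halign : Q + Measure.map c Q = P + Measure.map c P)
    (φ : ι → ℝ) (hφ_meas : Measurable φ) (hφc : ∀ i, φ (c i) = φ i)
    (hφQ : Integrable φ Q)
    (hexp : Integrable (fun i => Real.exp (φ i)) P) :
    (∫ i, φ i ∂Q) ≤ Real.log (∫ i, Real.exp (φ i) ∂P) := by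
  have hmap := map_eq_map_of_add_map_eq hc_meas halign hφ_meas hφc
  have hident : ProbabilityTheory.IdentDistrib φ φ Q P :=
    ⟨hφ_meas.aemeasurable, hφ_meas.aemeasurable, hmap⟩
  rw [hident.integral_eq]
  exact integral_le_log_integral_exp (hident.integrable_iff.1 hφQ) hexp
end

section
/- (Generalization of Maurer's lemma to trivalent variables.) Let (X,Y) be a random variable with values in [0,1]² satisfying X + Y ≤ 1, with expectations μ_X = E[X] and μ_Y = E[Y]. Let (X',Y') be the random variable taking the values (1,0), (0,1), (0,0) with probabilities μ_X, μ_Y, and 1 − μ_X − μ_Y respectively. Let ((X_1,Y_1),…,(X_n,Y_n)) be n independent copies of (X,Y) and ((X'_1,Y'_1),…,(X'_n,Y'_n)) be n independent copies of (X',Y'). Then for every convex function f : [0,1]^n × [0,1]^n → ℝ, E[f((X_1,…,X_n),(Y_1,…,Y_n))] ≤ E[f((X'_1,…,X'_n),(Y'_1,…,Y'_n))]. -/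
open MeasureTheory

/-- The product of probability vectors on a finite type `κ` has total mass one. -/
lemma sum_prod_weights_eq_one {ι κ : Type*} [Fintype ι] [DecidableEq ι] [Fintype κ]
    (w : ι → κ → ℝ) (hw : ∀ i, ∑ j, w i j = 1) :
    ∑ t : ι → κ, ∏ i, w i (t i) = 1 := by
  rw [← Fintype.prod_sum]
  simp [hw]

/-- Averaging a function of one coordinate against a product of probability vectors. -/
lemma sum_prod_weights_mul {ι κ : Type*} [Fintype ι] [DecidableEq ι] [Fintype κ]
    (w : ι → κ → ℝ) (hw : ∀ i, ∑ j, w i j = 1) (c : κ → ℝ) (k : ι) :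
    ∑ t : ι → κ, (∏ i, w i (t i)) * c (t k) = ∑ j, w k j * c j := by
  have h : ∀ t : ι → κ, (∏ i, w i (t i)) * c (t k)
      = ∏ i, w i (t i) * (if i = k then c (t i) else 1) := by
    intro t
    rw [Finset.prod_mul_distrib]
    simp
  simp_rw [h]
  rw [← Fintype.prod_sum (fun i j => w i j * (if i = k then c j else 1)),
    Finset.prod_eq_single k]
  · simp
  · intro i _ hi
    simp [hi, hw]
  · simp

/-- A convex function on `[0,1]ⁿ × [0,1]ⁿ` is bounded by its average over vertices, with respect
to a product of probability vectors having the prescribed barycenter. -/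
lemma ConvexOn.le_sum_prod_weights {ι κ : Type*} [Fintype ι] [DecidableEq ι] [Fintype κ]
    {f : (ι → ℝ) × (ι → ℝ) → ℝ}
    (hf : ConvexOn ℝ
      {p : (ι → ℝ) × (ι → ℝ) |
        (∀ i, p.1 i ∈ Set.Icc (0 : ℝ) 1) ∧ ∀ i, p.2 i ∈ Set.Icc (0 : ℝ) 1} f)
    (a b : κ → ℝ) (ha : ∀ j, a j ∈ Set.Icc (0 : ℝ) 1) (hb : ∀ j, b j ∈ Set.Icc (0 : ℝ) 1)
    (w : ι → κ → ℝ) (hw0 : ∀ i j, 0 ≤ w i j) (hw : ∀ i, ∑ j, w i j = 1) :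
    f (fun i => ∑ j, w i j * a j, fun i => ∑ j, w i j * b j) ≤
      ∑ t : ι → κ, (∏ i, w i (t i)) * f (fun i => a (t i), fun i => b (t i)) := by
  have h := hf.map_sum_le (t := Finset.univ) (w := fun t : ι → κ => ∏ i, w i (t i))
    (p := fun t => (fun i => a (t i), fun i => b (t i)))
    (fun t _ => Finset.prod_nonneg fun i _ => hw0 i _)
    (sum_prod_weights_eq_one w hw)
    (fun t _ => ⟨fun i => ha _, fun i => hb _⟩)
  simp only [smul_eq_mul] at h
  refine (congrArg f (Prod.ext ?_ ?_)).trans_le h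
  · ext k
    simp [Prod.fst_sum, Finset.sum_apply, sum_prod_weights_mul w hw a k]
  · ext k
    simp [Prod.snd_sum, Finset.sum_apply, sum_prod_weights_mul w hw b k]

/-- If the random probability vector `w` on the finite type `κ` has mean `ν`, then averaging
a function against independent copies of `w` has expectation its integral against the power
of `ν`. -/
lemma integral_sum_prod_weights {Ω ι κ : Type*} [MeasurableSpace Ω] [Fintype ι] [DecidableEq ι]
    [Fintype κ] [MeasurableSpace κ] [MeasurableSingletonClass κ]
    (μ : Measure Ω) [IsProbabilityMeasure μ] (ν : Measure κ) [IsFiniteMeasure ν]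
    (w : Ω → κ → ℝ) (hw : ∀ j, Integrable (fun ω => w ω j) μ)
    (hν : ∀ j, ν.real {j} = ∫ ω, w ω j ∂μ) (g : (ι → κ) → ℝ) :
    Integrable (fun ω : ι → Ω => ∑ t : ι → κ, (∏ i, w (ω i) (t i)) * g t)
        (Measure.pi fun _ : ι => μ) ∧
      ∫ ω, ∑ t : ι → κ, (∏ i, w (ω i) (t i)) * g t ∂(Measure.pi fun _ : ι => μ) =
        ∫ t, g t ∂(Measure.pi fun _ : ι => ν) := by
  have hi : ∀ t : ι → κ, Integrable (fun ω : ι → Ω => (∏ i, w (ω i) (t i)) * g t)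
      (Measure.pi fun _ : ι => μ) := fun t =>
    (Integrable.fintype_prod (f := fun i ω => w ω (t i)) fun i => hw (t i)).mul_const _
  refine ⟨integrable_finsetSum _ fun t _ => hi t, ?_⟩
  rw [integral_finsetSum _ fun t _ => hi t, integral_fintype .of_finite]
  refine Finset.sum_congr rfl fun t _ => ?_
  rw [integral_mul_const, integral_fintype_prod_eq_prod (fun i ω => w ω (t i)),
    measureReal_def, Measure.pi_singleton, ENNReal.toReal_prod, smul_eq_mul]
  simp_rw [← measureReal_def, hν]

/-- Generalization of Maurer's lemma to trivalent variables: let `(X, Y)` be a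
`[0,1]²`-valued random variable with `X + Y ≤ 1`, and let `(X', Y')` be the trivalent
random variable on the three outcomes `(1,0), (0,1), (0,0)` with probabilities
`E[X], E[Y], 1 - E[X] - E[Y]` (built here on `Fin 3` with `X' = ![1,0,0]`,
`Y' = ![0,1,0]`).  Then for `n` independent copies and any convex
`f : [0,1]ⁿ × [0,1]ⁿ → ℝ`,
`E[f((X₁,…,Xₙ),(Y₁,…,Yₙ))] ≤ E[f((X'₁,…,X'ₙ),(Y'₁,…,Y'ₙ))]`. -/
theorem statement17 {Ω : Type*} [MeasurableSpace Ω]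
    (μ : Measure Ω) [IsProbabilityMeasure μ]
    (Xv Yv : Ω → ℝ) (hXm : Measurable Xv) (hYm : Measurable Yv)
    (hX01 : ∀ ω, Xv ω ∈ Set.Icc (0 : ℝ) 1) (hY01 : ∀ ω, Yv ω ∈ Set.Icc (0 : ℝ) 1)
    (hXY : ∀ ω, Xv ω + Yv ω ≤ 1)
    (n : ℕ)
    (f : (Fin n → ℝ) × (Fin n → ℝ) → ℝ)
    (hf : ConvexOn ℝ
      {p : (Fin n → ℝ) × (Fin n → ℝ) |
        (∀ i, p.1 i ∈ Set.Icc (0 : ℝ) 1) ∧ ∀ i, p.2 i ∈ Set.Icc (0 : ℝ) 1} f)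
    (hint : Integrable (fun ω : Fin n → Ω => f (fun i => Xv (ω i), fun i => Yv (ω i)))
      (Measure.pi fun _ : Fin n => μ)) :
    (∫ ω, f (fun i => Xv (ω i), fun i => Yv (ω i)) ∂(Measure.pi fun _ : Fin n => μ)) ≤
      ∫ t, f (fun i => (![(1 : ℝ), 0, 0]) (t i), fun i => (![(0 : ℝ), 1, 0]) (t i))
        ∂(Measure.pi fun _ : Fin n =>
          (ENNReal.ofReal (∫ ω, Xv ω ∂μ) • Measure.dirac (0 : Fin 3) +
            ENNReal.ofReal (∫ ω, Yv ω ∂μ) • Measure.dirac (1 : Fin 3) +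
            ENNReal.ofReal (1 - (∫ ω, Xv ω ∂μ) - ∫ ω, Yv ω ∂μ) •
              Measure.dirac (2 : Fin 3))) := by
  have hXi : Integrable Xv μ := Integrable.of_mem_Icc 0 1 hXm.aemeasurable (.of_forall hX01)
  have hYi : Integrable Yv μ := Integrable.of_mem_Icc 0 1 hYm.aemeasurable (.of_forall hY01)
  have hX0 : 0 ≤ ∫ ω, Xv ω ∂μ := integral_nonneg fun ω => (hX01 ω).1
  have hY0 : 0 ≤ ∫ ω, Yv ω ∂μ := integral_nonneg fun ω => (hY01 ω).1
  have hZ : ∫ ω, (1 - Xv ω - Yv ω) ∂μ = 1 - (∫ ω, Xv ω ∂μ) - ∫ ω, Yv ω ∂μ := by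
    have h : Integrable (fun ω => 1 - Xv ω) μ := (integrable_const 1).sub hXi
    rw [integral_sub h hYi, integral_sub (integrable_const 1) hXi]
    simp
  have hZ0 : 0 ≤ 1 - (∫ ω, Xv ω ∂μ) - ∫ ω, Yv ω ∂μ :=
    hZ ▸ integral_nonneg fun ω => by
      have := hXY ω
      simp only [Pi.zero_apply]
      linarith
  set ν : Measure (Fin 3) := ENNReal.ofReal (∫ ω, Xv ω ∂μ) • Measure.dirac (0 : Fin 3) +
    ENNReal.ofReal (∫ ω, Yv ω ∂μ) • Measure.dirac (1 : Fin 3) +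
    ENNReal.ofReal (1 - (∫ ω, Xv ω ∂μ) - ∫ ω, Yv ω ∂μ) • Measure.dirac (2 : Fin 3) with hν
  have : IsFiniteMeasure ν := ⟨by simp [hν]⟩
  let w : Ω → Fin 3 → ℝ := fun ω => ![Xv ω, Yv ω, 1 - Xv ω - Yv ω]
  have hw0 : ∀ ω j, 0 ≤ w ω j := by
    intro ω j
    have := hXY ω
    fin_cases j
    · exact (hX01 ω).1
    · exact (hY01 ω).1
    · change 0 ≤ 1 - Xv ω - Yv ω
      linarith
  have hw1 : ∀ ω, ∑ j, w ω j = 1 := by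
    intro ω
    simp [w, Fin.sum_univ_three]
  have hwi : ∀ j, Integrable (fun ω => w ω j) μ := by
    intro j
    fin_cases j
    · exact hXi
    · exact hYi
    · exact ((integrable_const 1).sub hXi).sub hYi
  have hwν : ∀ j, ν.real {j} = ∫ ω, w ω j ∂μ := by
    intro j
    fin_cases j
    · simp [hν, w, measureReal_def, hX0]
    · simp [hν, w, measureReal_def, hY0]
    · simp [hν, w, measureReal_def, hZ, hZ0]
  obtain ⟨hgi, hg⟩ := integral_sum_prod_weights (ι := Fin n) μ ν w hwi hwν
    (fun t => f (fun i => (![(1 : ℝ), 0, 0]) (t i), fun i => (![(0 : ℝ), 1, 0]) (t i)))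
  rw [← hg]
  refine integral_mono hint hgi fun ω => ?_
  have h := hf.le_sum_prod_weights ![(1 : ℝ), 0, 0] ![(0 : ℝ), 1, 0]
    (by intro j; fin_cases j <;> simp) (by intro j; fin_cases j <;> simp)
    (fun i => w (ω i)) (fun i => hw0 (ω i)) (fun i => hw1 (ω i))
  simpa [Fin.sum_univ_three, w] using h
end

section
/- Let H = {f_1,…,f_{2n}} be a finite self-complemented set of voters (f_{i+n} = −f_i). For every probability distribution Q on H there exist a quasi-uniform distribution Q' on H and a constant c > 0 such that E_{f∼Q'} f(x) = c·E_{f∼Q} f(x) for every x ∈ X. In particular, the majority votes coincide — sgn(E_{f∼Q'} f(x)) = sgn(E_{f∼Q} f(x)) for all x, so B_{Q'} = B_Q — and for every distribution D' on X × {-1,1} with μ2(M_Q^{D'}) > 0, the C-bound values coincide: 1 − μ1(M_{Q'}^{D'})²/μ2(M_{Q'}^{D'}) = 1 − μ1(M_Q^{D'})²/μ2(M_Q^{D'}). -/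
open MeasureTheory

/-- The output `E_{f∼Q} f(x)` of the `Q`-weighted vote over the finite
self-complemented set of voters `{F (i,false), F (i,true) = -F (i,false)}`. -/
noncomputable def voteSum {X : Type*} {n : ℕ} (F : Fin n × Bool → X → ℝ)
    (Q : Fin n × Bool → ℝ) (x : X) : ℝ :=
  ∑ j, Q j * F j x

/-- First moment of the margin `M_Q(x,y) = y·E_{f∼Q} f(x)` under `D'`. -/
noncomputable def trueMu1 {X : Type*} [MeasurableSpace X] {n : ℕ}
    (F : Fin n × Bool → X → ℝ) (Q : Fin n × Bool → ℝ) (D' : Measure (X × ℝ)) : ℝ :=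
  ∫ p, p.2 * voteSum F Q p.1 ∂D'

/-- Second moment of the margin under `D'`. -/
noncomputable def trueMu2 {X : Type*} [MeasurableSpace X] {n : ℕ}
    (F : Fin n × Bool → X → ℝ) (Q : Fin n × Bool → ℝ) (D' : Measure (X × ℝ)) : ℝ :=
  ∫ p, (p.2 * voteSum F Q p.1) ^ 2 ∂D'

/-- Over a self-complemented voter set, the vote only depends on the weight differences
between each voter and its complement. -/
theorem voteSum_eq_sum_sub {X : Type*} {n : ℕ} {F : Fin n × Bool → X → ℝ}
    (hcompl : ∀ (i : Fin n) (x : X), F (i, true) x = -(F (i, false) x))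
    (Q : Fin n × Bool → ℝ) (x : X) :
    voteSum F Q x = ∑ i, (Q (i, false) - Q (i, true)) * F (i, false) x := by
  rw [voteSum, Fintype.sum_prod_type]
  refine Finset.sum_congr rfl fun i _ => ?_
  rw [Fintype.sum_bool, hcompl]
  ring

theorem trueMu1_of_voteSum_eq {X : Type*} [MeasurableSpace X] {n : ℕ}
    {F : Fin n × Bool → X → ℝ} {Q Q' : Fin n × Bool → ℝ} {c : ℝ}
    (h : ∀ x, voteSum F Q' x = c * voteSum F Q x) (D' : Measure (X × ℝ)) :
    trueMu1 F Q' D' = c * trueMu1 F Q D' := by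
  simp only [trueMu1, h, mul_left_comm _ c, integral_const_mul]

theorem trueMu2_of_voteSum_eq {X : Type*} [MeasurableSpace X] {n : ℕ}
    {F : Fin n × Bool → X → ℝ} {Q Q' : Fin n × Bool → ℝ} {c : ℝ}
    (h : ∀ x, voteSum F Q' x = c * voteSum F Q x) (D' : Measure (X × ℝ)) :
    trueMu2 F Q' D' = c ^ 2 * trueMu2 F Q D' := by
  simp only [trueMu2, h, mul_left_comm _ c, mul_pow c, integral_const_mul]

theorem Real.sign_mul_of_pos {c : ℝ} (hc : 0 < c) (r : ℝ) :
    Real.sign (c * r) = Real.sign r := by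
  rcases lt_trichotomy r 0 with hr | rfl | hr
  · rw [Real.sign_of_neg hr, Real.sign_of_neg (mul_neg_of_pos_of_neg hc hr)]
  · rw [mul_zero]
  · rw [Real.sign_of_pos hr, Real.sign_of_pos (mul_pos hc hr)]

/-- For every distribution `Q` on a finite self-complemented set of `2n` voters there
is a quasi-uniform distribution `Q'` whose vote output is a positive multiple of that
of `Q`; hence the majority votes coincide (`B_{Q'} = B_Q`) and the C-bound values
coincide for every `D'` with `μ₂(M_Q^{D'}) > 0`. -/
theorem statement18 {X : Type*} [MeasurableSpace X] (n : ℕ) (hn : 0 < n)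
    (F : Fin n × Bool → X → ℝ) (hF : ∀ j x, F j x ∈ Set.Icc (-1 : ℝ) 1)
    (hcompl : ∀ (i : Fin n) (x : X), F (i, true) x = -(F (i, false) x))
    (Q : Fin n × Bool → ℝ) (hQ0 : ∀ j, 0 ≤ Q j) (hQ1 : ∑ j, Q j = 1) :
    ∃ Q' : Fin n × Bool → ℝ,
      (∀ j, 0 ≤ Q' j) ∧ (∑ j, Q' j = 1) ∧
      (∀ i : Fin n, Q' (i, false) + Q' (i, true) = 1 / (n : ℝ)) ∧
      ∃ c : ℝ, 0 < c ∧
        (∀ x, voteSum F Q' x = c * voteSum F Q x) ∧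
        (∀ x, Real.sign (voteSum F Q' x) = Real.sign (voteSum F Q x)) ∧
        (∀ D' : Measure (X × ℝ), IsProbabilityMeasure D' →
          (∀ᵐ p ∂D', p.2 = 1 ∨ p.2 = -1) →
          0 < trueMu2 F Q D' →
          1 - (trueMu1 F Q' D') ^ 2 / trueMu2 F Q' D'
            = 1 - (trueMu1 F Q D') ^ 2 / trueMu2 F Q D') := by
  have hn' : (0 : ℝ) < n := Nat.cast_pos.mpr hn
  have hc : (0 : ℝ) < 1 / n := one_div_pos.mpr hn'
  have hQle : ∀ j, Q j ≤ 1 := fun j =>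
    hQ1 ▸ Finset.single_le_sum (fun k _ => hQ0 k) (Finset.mem_univ j)
  set Q' : Fin n × Bool → ℝ := fun j => 1 / n * ((1 + Q j - Q (j.1, !j.2)) / 2) with hQ'
  have hquasi : ∀ i : Fin n, Q' (i, false) + Q' (i, true) = 1 / (n : ℝ) := fun i => by
    simp only [hQ', Bool.not_false, Bool.not_true]
    ring
  have hvote : ∀ x, voteSum F Q' x = 1 / n * voteSum F Q x := fun x => by
    rw [voteSum_eq_sum_sub hcompl, voteSum_eq_sum_sub hcompl, Finset.mul_sum]
    refine Finset.sum_congr rfl fun i _ => ?_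
    simp only [hQ', Bool.not_false, Bool.not_true]
    ring
  refine ⟨Q', fun j => ?_, ?_, hquasi, 1 / n, hc, hvote, fun x => ?_, fun D' _ _ _ => ?_⟩
  · refine mul_nonneg hc.le ?_
    linarith [hQ0 j, hQle (j.1, !j.2)]
  · simp only [Fintype.sum_prod_type, Fintype.sum_bool, add_comm (Q' (_, true)), hquasi,
      Finset.sum_const, Finset.card_univ, Fintype.card_fin, nsmul_eq_mul]
    exact mul_one_div_cancel hn'.ne'
  · rw [hvote, Real.sign_mul_of_pos hc]
  · rw [trueMu1_of_voteSum_eq hvote, trueMu2_of_voteSum_eq hvote, mul_pow,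
      mul_div_mul_left _ _ (pow_pos hc 2).ne']
end
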